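/- arXiv:1902.10087 — 3 statements merged into one kernel-verified Lean document; each statement's English description precedes it below -/
import Mathlib

section
/- Let τ be an invertible density operator on H_A⊗H_B⊗H_C with Tr_C τ = ρ_AB and Tr_A τ = ρ_BC, and suppose there exists a Hermitian operator θ_B on H_B (extended to the full space by tensoring with identities) such that log τ = log ρ_AB + log ρ_BC + θ_B (all logarithms extended by identities). Then I_τ(A:C|B) = 0, i.e., τ is a quantum Markov chain in order A−B−C. -/
open scoped Matrix ComplexOrder

variable {A B C : Type*}

/-- Functional calculus for Hermitian matrices: apply `f : ℝ → ℝ` to the eigenvalues. -/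
noncomputable def matFun {n : Type*} [Fintype n] [DecidableEq n]
    (f : ℝ → ℝ) (ρ : Matrix n n ℂ) : Matrix n n ℂ :=
  if h : ρ.IsHermitian then
    (h.eigenvectorUnitary : Matrix n n ℂ) *
      Matrix.diagonal (fun i => (f (h.eigenvalues i) : ℂ)) *
        (star (h.eigenvectorUnitary : Matrix n n ℂ))
  else 0

/-- Matrix logarithm via functional calculus. -/
noncomputable def matLog {n : Type*} [Fintype n] [DecidableEq n] (ρ : Matrix n n ℂ) :
    Matrix n n ℂ := matFun Real.log ρ

/-- Matrix square root via functional calculus. -/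
noncomputable def matSqrt {n : Type*} [Fintype n] [DecidableEq n] (ρ : Matrix n n ℂ) :
    Matrix n n ℂ := matFun Real.sqrt ρ

/-- Matrix inverse square root via functional calculus. -/
noncomputable def matInvSqrt {n : Type*} [Fintype n] [DecidableEq n] (ρ : Matrix n n ℂ) :
    Matrix n n ℂ := matFun (fun x => (Real.sqrt x)⁻¹) ρ

/-- A density operator: positive semidefinite with trace one. -/
def IsDensity {n : Type*} [Fintype n] (ρ : Matrix n n ℂ) : Prop :=
  ρ.PosSemidef ∧ ρ.trace = 1

/-- The von Neumann entropy `S(ρ) = -Tr(ρ log ρ)`, computed via eigenvalues. -/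
noncomputable def vnEntropy {n : Type*} [Fintype n] [DecidableEq n] (ρ : Matrix n n ℂ) : ℝ :=
  if h : ρ.IsHermitian then -∑ i, h.eigenvalues i * Real.log (h.eigenvalues i) else 0

/-- The quantum relative entropy `S(ρ‖σ) = Tr[ρ (log ρ - log σ)]`. -/
noncomputable def relEntropy {n : Type*} [Fintype n] [DecidableEq n]
    (ρ σ : Matrix n n ℂ) : ℝ := ((ρ * (matLog ρ - matLog σ)).trace).re

section Tripartite

variable [Fintype A] [Fintype B] [Fintype C]

/-- Partial trace over the third factor. -/
noncomputable def ptC (ρ : Matrix (A × B × C) (A × B × C) ℂ) : Matrix (A × B) (A × B) ℂ :=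
  fun x y => ∑ c : C, ρ (x.1, x.2, c) (y.1, y.2, c)

/-- Partial trace over the first factor. -/
noncomputable def ptA (ρ : Matrix (A × B × C) (A × B × C) ℂ) : Matrix (B × C) (B × C) ℂ :=
  fun x y => ∑ a : A, ρ (a, x) (a, y)

/-- Partial trace over the first and third factors. -/
noncomputable def ptAC (ρ : Matrix (A × B × C) (A × B × C) ℂ) : Matrix B B ℂ :=
  fun b b' => ∑ a : A, ∑ c : C, ρ (a, b, c) (a, b', c)

/-- Partial trace over the first and second factors. -/
noncomputable def ptAB (ρ : Matrix (A × B × C) (A × B × C) ℂ) : Matrix C C ℂ :=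
  fun c c' => ∑ a : A, ∑ b : B, ρ (a, b, c) (a, b, c')

/-- Partial trace over the second and third factors. -/
noncomputable def ptBC (ρ : Matrix (A × B × C) (A × B × C) ℂ) : Matrix A A ℂ :=
  fun a a' => ∑ b : B, ∑ c : C, ρ (a, b, c) (a', b, c)

/-- Partial trace of a bipartite state over its first factor. -/
noncomputable def bptFst {X Y : Type*} [Fintype X] [Fintype Y]
    (M : Matrix (X × Y) (X × Y) ℂ) : Matrix Y Y ℂ :=
  fun b b' => ∑ x : X, M (x, b) (x, b')

/-- Partial trace of a bipartite state over its second factor. -/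
noncomputable def bptSnd {X Y : Type*} [Fintype X] [Fintype Y]
    (M : Matrix (X × Y) (X × Y) ℂ) : Matrix X X ℂ :=
  fun a a' => ∑ y : Y, M (a, y) (a', y)

variable [DecidableEq A] [DecidableEq B] [DecidableEq C]

/-- Extend an operator on the first two factors to the tripartite space: `M ⊗ id_C`. -/
noncomputable def extAB (M : Matrix (A × B) (A × B) ℂ) :
    Matrix (A × B × C) (A × B × C) ℂ :=
  fun x y => M (x.1, x.2.1) (y.1, y.2.1) * (if x.2.2 = y.2.2 then 1 else 0)

/-- Extend an operator on the last two factors to the tripartite space: `id_A ⊗ M`. -/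
noncomputable def extBC (M : Matrix (B × C) (B × C) ℂ) :
    Matrix (A × B × C) (A × B × C) ℂ :=
  fun x y => (if x.1 = y.1 then 1 else 0) * M x.2 y.2

/-- Extend an operator on the middle factor to the tripartite space: `id_A ⊗ M ⊗ id_C`. -/
noncomputable def extB (M : Matrix B B ℂ) : Matrix (A × B × C) (A × B × C) ℂ :=
  fun x y => (if x.1 = y.1 then 1 else 0) * M x.2.1 y.2.1 * (if x.2.2 = y.2.2 then 1 else 0)

/-- Quantum conditional mutual information `I_ρ(A:C|B)`. -/
noncomputable def qcmi (ρ : Matrix (A × B × C) (A × B × C) ℂ) : ℝ :=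
  vnEntropy (ptC ρ) + vnEntropy (ptA ρ) - vnEntropy (ptAC ρ) - vnEntropy ρ

end Tripartite

namespace QMCProof

open Matrix Filter Topology

/-- `L` is a logarithm of the positive definite matrix `ρ`, witnessed by a diagonalization. -/
def HasLog {n : Type*} [Fintype n] [DecidableEq n] (ρ L : Matrix n n ℂ) : Prop :=
  ∃ (U : Matrix n n ℂ) (p : n → ℝ), Uᴴ * U = 1 ∧ U * Uᴴ = 1 ∧ (∀ i, 0 < p i) ∧
    ρ = U * diagonal (fun i => (p i : ℂ)) * Uᴴ ∧
    L = U * diagonal (fun i => (Real.log (p i) : ℂ)) * Uᴴ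

/-- The variational functional. -/
noncomputable def Jf {n : Type*} [Fintype n] (ρ σ : Matrix n n ℂ) (t : ℝ) (X : Matrix n n ℂ) : ℝ :=
  2 * ((Xᴴ * ρ).trace).re - ((X * Xᴴ * σ).trace).re - t * ((Xᴴ * X * ρ).trace).re

/-- The resolvent quantity. -/
noncomputable def Qf {n : Type*} [Fintype n] (W : Matrix n n ℂ) (p q : n → ℝ) (t : ℝ) : ℝ :=
  ∑ j, ∑ i, Complex.normSq (W j i) * (p i ^ 2 / (q j + t * p i))

/-- The integrated resolvent quantity. -/
noncomputable def Ff {n : Type*} [Fintype n] (W : Matrix n n ℂ) (p q : n → ℝ) (t : ℝ) : ℝ :=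
  ∑ j, ∑ i, Complex.normSq (W j i) * (p i * (Real.log (q j + t * p i) - Real.log (q j)))

section single

variable {n : Type*} [Fintype n] [DecidableEq n]

lemma trace_form (U V : Matrix n n ℂ) (p g : n → ℝ) :
    (((U * diagonal (fun i => (p i : ℂ)) * Uᴴ) *
      (V * diagonal (fun i => (g i : ℂ)) * Vᴴ)).trace).re =
    ∑ j, ∑ i, Complex.normSq ((Vᴴ * U) j i) * (p i * g j) := by
  have h : ((U * diagonal (fun i => (p i : ℂ)) * Uᴴ) *
      (V * diagonal (fun i => (g i : ℂ)) * Vᴴ)).trace =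
      (((Vᴴ * U) * diagonal (fun i => (p i : ℂ))) *
        ((Vᴴ * U)ᴴ * diagonal (fun i => (g i : ℂ)))).trace := by
    rw [conjTranspose_mul, conjTranspose_conjTranspose]
    rw [← Matrix.mul_assoc, Matrix.trace_mul_comm]
    simp only [Matrix.mul_assoc]
  rw [h]
  simp only [Matrix.trace, Matrix.diag_apply, Matrix.mul_apply (M := (Vᴴ * U) * _),
    mul_diagonal, conjTranspose_apply, Complex.re_sum]
  refine Finset.sum_congr rfl fun j _ => Finset.sum_congr rfl fun i _ => ?_
  generalize (Vᴴ * U) j i = w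
  simp [Complex.normSq_apply]
  ring

lemma J_form (U V Y : Matrix n n ℂ) (hU : Uᴴ * U = 1) (hV : Vᴴ * V = 1) (p q : n → ℝ) (t : ℝ) :
    Jf (U * diagonal (fun i => (p i : ℂ)) * Uᴴ) (V * diagonal (fun i => (q i : ℂ)) * Vᴴ) t
      (V * Y * Uᴴ) =
    ∑ j, ∑ i, (2 * (star (Y j i) * (Vᴴ * U) j i).re * p i
      - (q j + t * p i) * Complex.normSq (Y j i)) := by
  have hU' : ∀ Z : Matrix n n ℂ, Uᴴ * (U * Z) = Z := fun Z => by
    rw [← Matrix.mul_assoc, hU, Matrix.one_mul]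
  have hV' : ∀ Z : Matrix n n ℂ, Vᴴ * (V * Z) = Z := fun Z => by
    rw [← Matrix.mul_assoc, hV, Matrix.one_mul]
  have h1 : ((V * Y * Uᴴ)ᴴ * (U * diagonal (fun i => (p i : ℂ)) * Uᴴ)).trace =
      ((Vᴴ * U * diagonal (fun i => (p i : ℂ))) * Yᴴ).trace := by
    simp only [conjTranspose_mul, conjTranspose_conjTranspose]
    rw [Matrix.trace_mul_comm]
    simp only [Matrix.mul_assoc, hU']
    rw [← Matrix.mul_assoc, ← Matrix.mul_assoc, Matrix.trace_mul_comm]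
    simp only [Matrix.mul_assoc]
  have h2 : ((V * Y * Uᴴ) * (V * Y * Uᴴ)ᴴ * (V * diagonal (fun i => (q i : ℂ)) * Vᴴ)).trace =
      (Y * (Yᴴ * diagonal (fun i => (q i : ℂ)))).trace := by
    simp only [conjTranspose_mul, conjTranspose_conjTranspose, Matrix.mul_assoc, hU', hV']
    rw [Matrix.trace_mul_comm]
    simp only [Matrix.mul_assoc, hV, Matrix.mul_one]
  have h3 : ((V * Y * Uᴴ)ᴴ * (V * Y * Uᴴ) * (U * diagonal (fun i => (p i : ℂ)) * Uᴴ)).trace =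
      ((Y * diagonal (fun i => (p i : ℂ))) * Yᴴ).trace := by
    simp only [conjTranspose_mul, conjTranspose_conjTranspose, Matrix.mul_assoc, hU', hV']
    rw [Matrix.trace_mul_comm]
    simp only [Matrix.mul_assoc, hU, Matrix.mul_one]
    rw [Matrix.trace_mul_comm]
    simp only [Matrix.mul_assoc]
  rw [Jf, h1, h2, h3]
  simp only [Matrix.trace, Matrix.diag_apply, Matrix.mul_apply (N := Yᴴ),
    Matrix.mul_apply (M := Y),
    mul_diagonal, diagonal_apply, conjTranspose_apply, Complex.re_sum, Finset.mul_sum,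
    mul_ite, mul_zero, Finset.sum_ite_eq', Finset.mem_univ, if_true]
  simp only [← Finset.sum_sub_distrib]
  refine Finset.sum_congr rfl fun j _ => Finset.sum_congr rfl fun i _ => ?_
  generalize (Vᴴ * U) j i = w
  simp [Complex.normSq_apply]
  ring

lemma J_le (U V X : Matrix n n ℂ) (hU : Uᴴ * U = 1) (hV : Vᴴ * V = 1)
    (hU2 : U * Uᴴ = 1) (hV2 : V * Vᴴ = 1) (p q : n → ℝ) (hp : ∀ i, 0 < p i) (hq : ∀ i, 0 < q i)
    (t : ℝ) (ht : 0 ≤ t) :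
    Jf (U * diagonal (fun i => (p i : ℂ)) * Uᴴ) (V * diagonal (fun i => (q i : ℂ)) * Vᴴ) t X
      ≤ Qf (Vᴴ * U) p q t := by
  have hX : X = V * (Vᴴ * X * U) * Uᴴ := by
    simp only [Matrix.mul_assoc, hU2, Matrix.mul_one]
    rw [← Matrix.mul_assoc, hV2, Matrix.one_mul]
  rw [hX, J_form U V _ hU hV, Qf]
  refine Finset.sum_le_sum fun j _ => Finset.sum_le_sum fun i _ => ?_
  generalize (Vᴴ * U) j i = w
  generalize (Vᴴ * X * U) j i = y
  have hd : 0 < q j + t * p i := by have := hp i; have := hq j; positivity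
  rw [← mul_div_assoc, le_div_iff₀ hd]
  generalize q j + t * p i = d at *
  simp only [Complex.normSq_apply, Complex.mul_re, Complex.star_def, Complex.conj_re,
    Complex.conj_im]
  nlinarith [sq_nonneg (d * y.re - p i * w.re), sq_nonneg (d * y.im - p i * w.im)]

lemma J_attained (U V : Matrix n n ℂ) (hU : Uᴴ * U = 1) (hV : Vᴴ * V = 1)
    (p q : n → ℝ) (hp : ∀ i, 0 < p i) (hq : ∀ i, 0 < q i)
    (t : ℝ) (ht : 0 ≤ t) : ∃ X,
    Jf (U * diagonal (fun i => (p i : ℂ)) * Uᴴ) (V * diagonal (fun i => (q i : ℂ)) * Vᴴ) t X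
      = Qf (Vᴴ * U) p q t := by
  refine ⟨V * (Matrix.of fun j i => (Vᴴ * U) j i * ((p i / (q j + t * p i) : ℝ) : ℂ)) * Uᴴ, ?_⟩
  rw [J_form U V _ hU hV, Qf]
  refine Finset.sum_congr rfl fun j _ => Finset.sum_congr rfl fun i _ => ?_
  simp only [Matrix.of_apply]
  generalize (Vᴴ * U) j i = w
  have hd : 0 < q j + t * p i := by have := hp i; have := hq j; positivity
  generalize q j + t * p i = d at *
  rw [Complex.normSq_mul, Complex.normSq_ofReal]
  simp only [Complex.normSq_apply, Complex.mul_re, Complex.mul_im, Complex.star_def,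
    Complex.conj_re, Complex.conj_im, Complex.ofReal_re, Complex.ofReal_im]
  field_simp
  ring

lemma hasDeriv_F (W : Matrix n n ℂ) (p q : n → ℝ) (hp : ∀ i, 0 < p i) (hq : ∀ i, 0 < q i)
    (t : ℝ) (ht : 0 ≤ t) : HasDerivAt (Ff W p q) (Qf W p q t) t := by
  unfold Ff Qf
  refine HasDerivAt.fun_sum fun j _ => HasDerivAt.fun_sum fun i _ => ?_
  have hd : 0 < q j + t * p i := by have := hp i; have := hq j; positivity
  have h1 : HasDerivAt (fun t : ℝ => q j + t * p i) (p i) t := by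
    simpa using ((hasDerivAt_id t).mul_const (p i)).const_add (q j)
  have h2 := (((h1.log hd.ne').sub_const (Real.log (q j))).const_mul (p i)).const_mul
    (Complex.normSq (W j i))
  have h3 : p i ^ 2 / (q j + t * p i) = p i * (p i / (q j + t * p i)) := by
    rw [sq, mul_div_assoc]
  rw [h3]
  exact h2

lemma tendsto_F (W : Matrix n n ℂ) (p q : n → ℝ) (hp : ∀ i, 0 < p i) (hq : ∀ i, 0 < q i) :
    Tendsto (fun t : ℝ => Ff W p q t -
        Real.log t * ∑ j, ∑ i, Complex.normSq (W j i) * (p i * 1)) atTop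
      (𝓝 (∑ j, ∑ i, Complex.normSq (W j i) * (p i * (Real.log (p i) - Real.log (q j))))) := by
  have h1 : Tendsto (fun t : ℝ => ∑ j, ∑ i, Complex.normSq (W j i) *
      (p i * (Real.log (p i + q j * t⁻¹) - Real.log (q j)))) atTop
      (𝓝 (∑ j, ∑ i, Complex.normSq (W j i) * (p i * (Real.log (p i) - Real.log (q j))))) := by
    refine tendsto_finsetSum _ fun j _ => tendsto_finsetSum _ fun i _ => ?_
    refine Tendsto.const_mul _ (Tendsto.const_mul _ (Tendsto.sub_const ?_ _))
    refine Tendsto.log ?_ (hp i).ne'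
    simpa using (tendsto_inv_atTop_zero.const_mul (q j)).const_add (p i)
  refine h1.congr' ?_
  filter_upwards [eventually_gt_atTop 0] with t ht
  rw [Ff, Finset.mul_sum, ← Finset.sum_sub_distrib]
  refine Finset.sum_congr rfl fun j _ => ?_
  rw [Finset.mul_sum, ← Finset.sum_sub_distrib]
  refine Finset.sum_congr rfl fun i _ => ?_
  have hd : 0 < q j + t * p i := by have := hp i; have := hq j; positivity
  have : p i + q j * t⁻¹ = (q j + t * p i) / t := by field_simp; ring
  rw [this, Real.log_div hd.ne' ht.ne']
  ring

end single

section DPI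

variable {m k : Type*} [Fintype m] [Fintype k] [DecidableEq m] [DecidableEq k]

lemma trace_bptFst (X : Matrix m m ℂ) (ρ : Matrix (k × m) (k × m) ℂ) :
    (((1 : Matrix k k ℂ).kronecker X) * ρ).trace = (X * bptFst ρ).trace := by
  simp only [Matrix.trace, Matrix.diag_apply, Matrix.mul_apply, bptFst, Fintype.sum_prod_type,
    Matrix.kronecker, Matrix.kroneckerMap_apply, Matrix.one_apply, ite_mul, one_mul, zero_mul,
    Finset.mul_sum]
  simp
  rw [Finset.sum_comm]
  refine Finset.sum_congr rfl fun i _ => Finset.sum_comm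

lemma J_bptFst (ρ σ : Matrix (k × m) (k × m) ℂ) (t : ℝ) (X : Matrix m m ℂ) :
    Jf ρ σ t ((1 : Matrix k k ℂ).kronecker X) = Jf (bptFst ρ) (bptFst σ) t X := by
  have hs : ((1 : Matrix k k ℂ).kronecker X)ᴴ = (1 : Matrix k k ℂ).kronecker Xᴴ := by
    simpa using conjTranspose_kronecker (1 : Matrix k k ℂ) X
  have hm : ∀ Y Z : Matrix m m ℂ, ((1 : Matrix k k ℂ).kronecker Y) *
      ((1 : Matrix k k ℂ).kronecker Z) = (1 : Matrix k k ℂ).kronecker (Y * Z) := fun Y Z => by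
    simpa using (mul_kronecker_mul (1 : Matrix k k ℂ) 1 Y Z).symm
  unfold Jf
  rw [hs, hm, hm, trace_bptFst, trace_bptFst, trace_bptFst]

lemma trace_eq_bptFst (ρ : Matrix (k × m) (k × m) ℂ) : (bptFst ρ).trace = ρ.trace := by
  simp only [Matrix.trace, Matrix.diag_apply, bptFst, Fintype.sum_prod_type]
  exact Finset.sum_comm

lemma trace_w {n : Type*} [Fintype n] [DecidableEq n] (U V : Matrix n n ℂ) (hV : V * Vᴴ = 1)
    (p : n → ℝ) :
    ∑ j, ∑ i, Complex.normSq ((Vᴴ * U) j i) * (p i * 1) =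
      ((U * diagonal (fun i => (p i : ℂ)) * Uᴴ).trace).re := by
  have := trace_form U V p (fun _ => 1)
  rw [← this]
  simp [hV]

lemma relEnt_form {n : Type*} [Fintype n] [DecidableEq n] (U V : Matrix n n ℂ)
    (hU : Uᴴ * U = 1) (hV : V * Vᴴ = 1) (p q : n → ℝ) :
    ((U * diagonal (fun i => (p i : ℂ)) * Uᴴ *
      (U * diagonal (fun i => (Real.log (p i) : ℂ)) * Uᴴ -
       V * diagonal (fun i => (Real.log (q i) : ℂ)) * Vᴴ)).trace).re =
    ∑ j, ∑ i, Complex.normSq ((Vᴴ * U) j i) * (p i * (Real.log (p i) - Real.log (q j))) := by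
  have h1 := trace_form U V p (fun j => Real.log (q j))
  have h2 := trace_w U V hV (fun i => p i * Real.log (p i))
  have h3 : U * diagonal (fun i => (p i : ℂ)) * Uᴴ *
      (U * diagonal (fun i => (Real.log (p i) : ℂ)) * Uᴴ) =
      U * diagonal (fun i => ((p i * Real.log (p i) : ℝ) : ℂ)) * Uᴴ := by
    have : (fun i => ((p i * Real.log (p i) : ℝ) : ℂ)) =
      fun i => (p i : ℂ) * (Real.log (p i) : ℂ) := by funext i; push_cast; rfl
    rw [this, ← diagonal_mul_diagonal]
    simp only [Matrix.mul_assoc]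
    rw [← Matrix.mul_assoc Uᴴ U, hU, Matrix.one_mul]
  rw [Matrix.mul_sub, Matrix.trace_sub, Complex.sub_re, h1, h3, ← h2, ← Finset.sum_sub_distrib]
  refine Finset.sum_congr rfl fun j _ => ?_
  rw [← Finset.sum_sub_distrib]
  refine Finset.sum_congr rfl fun i _ => ?_
  ring

/-- Monotonicity of relative entropy under partial trace. -/
theorem dpi (ρ σ L K : Matrix (k × m) (k × m) ℂ) (L' K' : Matrix m m ℂ)
    (hρ : HasLog ρ L) (hσ : HasLog σ K) (hρ' : HasLog (bptFst ρ) L') (hσ' : HasLog (bptFst σ) K') :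
    ((bptFst ρ * (L' - K')).trace).re ≤ ((ρ * (L - K)).trace).re := by
  obtain ⟨U, p, hU, hU2, hp, hρe, hLe⟩ := hρ
  obtain ⟨V, q, hV, hV2, hq, hσe, hKe⟩ := hσ
  obtain ⟨U', p', hU', hU2', hp', hρe', hLe'⟩ := hρ'
  obtain ⟨V', q', hV', hV2', hq', hσe', hKe'⟩ := hσ'
  have hQ : ∀ t : ℝ, 0 ≤ t → Qf (V'ᴴ * U') p' q' t ≤ Qf (Vᴴ * U) p q t := by
    intro t ht
    obtain ⟨X, hX⟩ := J_attained U' V' hU' hV' p' q' hp' hq' t ht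
    rw [← hX, ← hρe', ← hσe', ← J_bptFst, hρe, hσe]
    exact J_le U V _ hU hV hU2 hV2 p q hp hq t ht
  have hmono : MonotoneOn (fun t => Ff (Vᴴ * U) p q t - Ff (V'ᴴ * U') p' q' t) (Set.Ici 0) := by
    have hd : ∀ t : ℝ, 0 ≤ t → HasDerivAt (fun t => Ff (Vᴴ * U) p q t - Ff (V'ᴴ * U') p' q' t)
        (Qf (Vᴴ * U) p q t - Qf (V'ᴴ * U') p' q' t) t := fun t ht =>
      (hasDeriv_F _ p q hp hq t ht).sub (hasDeriv_F _ p' q' hp' hq' t ht)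
    refine monotoneOn_of_hasDerivWithinAt_nonneg (convex_Ici 0)
      (fun t ht => (hd t ht).continuousAt.continuousWithinAt)
      (fun t ht => (hd t ?_).hasDerivWithinAt) (fun t ht => sub_nonneg.2 (hQ t ?_))
    · exact interior_subset ht
    · exact interior_subset ht
  have hF : ∀ t : ℝ, 0 ≤ t → Ff (V'ᴴ * U') p' q' t ≤ Ff (Vᴴ * U) p q t := by
    intro t ht
    have := hmono (Set.mem_Ici.2 le_rfl) (Set.mem_Ici.2 ht) ht
    simpa [Ff] using this
  have htr : ∑ j, ∑ i, Complex.normSq ((V'ᴴ * U') j i) * (p' i * 1) =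
      ∑ j, ∑ i, Complex.normSq ((Vᴴ * U) j i) * (p i * 1) := by
    rw [trace_w _ _ hV2', trace_w _ _ hV2, ← hρe, ← hρe', trace_eq_bptFst]
  have e1 := relEnt_form U V hU hV2 p q
  have e2 := relEnt_form U' V' hU' hV2' p' q'
  rw [← hρe, ← hLe, ← hKe] at e1
  rw [← hρe', ← hLe', ← hKe'] at e2
  rw [e1, e2]
  refine le_of_tendsto_of_tendsto (tendsto_F (V'ᴴ * U') p' q' hp' hq')
    (tendsto_F (Vᴴ * U) p q hp hq) ?_
  filter_upwards [eventually_ge_atTop 0] with t ht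
  rw [htr]
  exact sub_le_sub_right (hF t ht) _

end DPI

section logs

variable {n : Type*} [Fintype n] [DecidableEq n]

lemma spectral' (ρ : Matrix n n ℂ) (h : ρ.IsHermitian) :
    ρ = (h.eigenvectorUnitary : Matrix n n ℂ) * diagonal (fun i => (h.eigenvalues i : ℂ)) *
      (h.eigenvectorUnitary : Matrix n n ℂ)ᴴ := by
  have := h.spectral_theorem
  rw [Unitary.conjStarAlgAut_apply] at this
  exact this

lemma hasLog_matLog (ρ : Matrix n n ℂ) (h : ρ.PosDef) : HasLog ρ (matLog ρ) := by
  refine ⟨h.1.eigenvectorUnitary, h.1.eigenvalues, ?_, ?_, h.eigenvalues_pos, spectral' ρ h.1, ?_⟩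
  · exact Unitary.coe_star_mul_self h.1.eigenvectorUnitary
  · exact Unitary.coe_mul_star_self h.1.eigenvectorUnitary
  · rw [matLog, matFun, dif_pos h.1]; rfl

lemma vnEntropy_eq (ρ : Matrix n n ℂ) (h : ρ.PosDef) :
    vnEntropy ρ = - ((ρ * matLog ρ).trace).re := by
  have hu : (h.1.eigenvectorUnitary : Matrix n n ℂ)ᴴ * h.1.eigenvectorUnitary = 1 :=
    Unitary.coe_star_mul_self h.1.eigenvectorUnitary
  have h1 := trace_form (h.1.eigenvectorUnitary : Matrix n n ℂ) h.1.eigenvectorUnitary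
    h.1.eigenvalues (fun i => Real.log (h.1.eigenvalues i))
  rw [← spectral' ρ h.1, hu] at h1
  have h2 : matLog ρ = (h.1.eigenvectorUnitary : Matrix n n ℂ) *
      diagonal (fun i => ((Real.log (h.1.eigenvalues i) : ℝ) : ℂ)) *
      (h.1.eigenvectorUnitary : Matrix n n ℂ)ᴴ := by
    rw [matLog, matFun, dif_pos h.1]; rfl
  rw [h2, h1, vnEntropy, dif_pos h.1]
  congr 1
  refine Finset.sum_congr rfl fun j _ => ?_
  rw [Finset.sum_eq_single j]
  · simp
  · intro b _ hb
    simp [Matrix.one_apply, hb.symm]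
  · simp

lemma hasLog_kron {k : Type*} [Fintype k] [DecidableEq k] (ρ L : Matrix n n ℂ) (h : HasLog ρ L) :
    HasLog (ρ.kronecker (1 : Matrix k k ℂ)) (L.kronecker (1 : Matrix k k ℂ)) := by
  obtain ⟨U, p, hU, hU2, hp, hρ, hL⟩ := h
  have hs : (U.kronecker (1 : Matrix k k ℂ))ᴴ = Uᴴ.kronecker 1 := by
    simpa using conjTranspose_kronecker U (1 : Matrix k k ℂ)
  have hm : ∀ Y Z : Matrix n n ℂ, (Y.kronecker (1 : Matrix k k ℂ)) *
      (Z.kronecker (1 : Matrix k k ℂ)) = (Y * Z).kronecker (1 : Matrix k k ℂ) := fun Y Z => by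
    simpa using (mul_kronecker_mul Y Z (1 : Matrix k k ℂ) 1).symm
  have h1 : (1 : Matrix n n ℂ).kronecker (1 : Matrix k k ℂ) = 1 := one_kronecker_one
  have hd : ∀ f : n → ℝ, diagonal (fun i : n × k => (f i.1 : ℂ)) =
      (diagonal (fun i => (f i : ℂ))).kronecker (1 : Matrix k k ℂ) := by
    intro f
    rw [← diagonal_one]
    refine Eq.trans ?_ (diagonal_kronecker_diagonal _ _).symm
    simp
  refine ⟨U.kronecker 1, fun i => p i.1, ?_, ?_, fun i => hp i.1, ?_, ?_⟩
  · rw [hs, hm, hU, h1]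
  · rw [hs, hm, hU2, h1]
  · rw [hd p, hs, hm, hm, ← hρ]
  · rw [hd (fun i => Real.log (p i)), hs, hm, hm, ← hL]

lemma hasLog_submatrix {k : Type*} [Fintype k] [DecidableEq k] (e : k ≃ n) (ρ L : Matrix n n ℂ)
    (h : HasLog ρ L) : HasLog (ρ.submatrix e e) (L.submatrix e e) := by
  obtain ⟨U, p, hU, hU2, hp, hρ, hL⟩ := h
  refine ⟨U.submatrix e e, p ∘ e, ?_, ?_, fun i => hp (e i), ?_, ?_⟩
  · rw [conjTranspose_submatrix, submatrix_mul_equiv, hU, submatrix_one_equiv]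
  · rw [conjTranspose_submatrix, submatrix_mul_equiv, hU2, submatrix_one_equiv]
  · have : diagonal (fun i => (((p ∘ e) i : ℝ) : ℂ)) =
        (diagonal (fun i => (p i : ℂ))).submatrix e e := (submatrix_diagonal_equiv (fun i => (p i : ℂ)) e).symm
    rw [this, conjTranspose_submatrix, submatrix_mul_equiv, submatrix_mul_equiv, ← hρ]
  · have : diagonal (fun i => ((Real.log ((p ∘ e) i) : ℝ) : ℂ)) =
        (diagonal (fun i => (Real.log (p i) : ℂ))).submatrix e e :=
      (submatrix_diagonal_equiv (fun i => (Real.log (p i) : ℂ)) e).symm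
    rw [this, conjTranspose_submatrix, submatrix_mul_equiv, submatrix_mul_equiv, ← hL]

end logs

section tri

variable {A B C : Type*} [Fintype A] [Fintype B] [Fintype C]
    [DecidableEq A] [DecidableEq B] [DecidableEq C]

lemma extAB_eq (M : Matrix (A × B) (A × B) ℂ) :
    (extAB M : Matrix (A × B × C) (A × B × C) ℂ) =
      (M.kronecker (1 : Matrix C C ℂ)).submatrix (Equiv.prodAssoc A B C).symm
        (Equiv.prodAssoc A B C).symm := by
  ext x y
  simp [extAB, Matrix.kronecker, Matrix.one_apply]

lemma hasLog_extAB (ρ L : Matrix (A × B) (A × B) ℂ) (h : HasLog ρ L) :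
    HasLog (extAB ρ : Matrix (A × B × C) (A × B × C) ℂ) (extAB L) := by
  rw [extAB_eq, extAB_eq]
  exact hasLog_submatrix _ _ _ (hasLog_kron _ _ h)

lemma bptFst_extAB (M : Matrix (A × B) (A × B) ℂ) :
    bptFst (extAB M : Matrix (A × B × C) (A × B × C) ℂ) =
      (bptFst M).kronecker (1 : Matrix C C ℂ) := by
  ext x y
  simp [bptFst, extAB, Matrix.kronecker, Matrix.one_apply]

lemma bptFst_ptC (τ : Matrix (A × B × C) (A × B × C) ℂ) : bptFst (ptC τ) = ptAC τ := by
  ext x y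
  simp [bptFst, ptC, ptAC]

lemma extBC_eq (M : Matrix (B × C) (B × C) ℂ) :
    (extBC M : Matrix (A × B × C) (A × B × C) ℂ) = (1 : Matrix A A ℂ).kronecker M := by
  ext x y
  simp [extBC, Matrix.kronecker, Matrix.one_apply]

lemma extB_eq (M : Matrix B B ℂ) :
    (extB M : Matrix (A × B × C) (A × B × C) ℂ) = extBC (M.kronecker (1 : Matrix C C ℂ)) := by
  ext x y
  simp [extBC, extB, Matrix.kronecker, Matrix.one_apply]

lemma tr_extBC (ρ : Matrix (A × B × C) (A × B × C) ℂ) (M : Matrix (B × C) (B × C) ℂ) :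
    (ρ * extBC M).trace = (bptFst ρ * M).trace := by
  rw [Matrix.trace_mul_comm, extBC_eq, trace_bptFst, Matrix.trace_mul_comm]

/-- trace of a matrix against an operator on the first factor -/
lemma tr_kron {m k : Type*} [Fintype m] [Fintype k] [DecidableEq k]
    (ρ : Matrix (m × k) (m × k) ℂ) (M : Matrix m m ℂ) :
    (ρ * M.kronecker (1 : Matrix k k ℂ)).trace = (bptSnd ρ * M).trace := by
  simp only [Matrix.trace, Matrix.diag_apply, Matrix.mul_apply, bptSnd, Fintype.sum_prod_type,
    Matrix.kronecker, Matrix.kroneckerMap_apply, Matrix.one_apply, mul_ite, mul_one, mul_zero,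
    Finset.sum_mul]
  simp
  refine Finset.sum_congr rfl fun i _ => Finset.sum_comm

lemma tr_extAB (τ : Matrix (A × B × C) (A × B × C) ℂ) (M : Matrix (A × B) (A × B) ℂ) :
    (τ * extAB M).trace = (ptC τ * M).trace := by
  simp only [Matrix.trace, Matrix.diag_apply, Matrix.mul_apply, ptC, Fintype.sum_prod_type,
    extAB, mul_ite, mul_one, mul_zero, Finset.sum_mul]
  simp
  refine Finset.sum_congr rfl fun i _ => Finset.sum_congr rfl fun j _ => ?_
  rw [Finset.sum_comm]
  refine Finset.sum_congr rfl fun i _ => Finset.sum_comm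

lemma bptSnd_ptA (τ : Matrix (A × B × C) (A × B × C) ℂ) : bptSnd (ptA τ) = ptAC τ := by
  ext x y
  simp only [bptSnd, ptA, ptAC]
  exact Finset.sum_comm

lemma bptSnd_kron (M : Matrix B B ℂ) :
    bptSnd (M.kronecker (1 : Matrix C C ℂ)) = (Fintype.card C : ℂ) • M := by
  ext x y
  simp [bptSnd, Matrix.kronecker]

lemma posDef_ptC [Nonempty C] (τ : Matrix (A × B × C) (A × B × C) ℂ) (h : τ.PosDef) :
    (ptC τ).PosDef := by
  have : ptC τ = ∑ c : C, τ.submatrix (fun x : A × B => (x.1, x.2, c)) (fun x => (x.1, x.2, c)) := by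
    ext x y
    simp [ptC, Matrix.sum_apply]
  rw [this]
  refine Matrix.posDef_sum Finset.univ_nonempty fun c _ => h.submatrix ?_
  rintro ⟨a, b⟩ ⟨a', b'⟩ h
  simpa using h

lemma posDef_bptFst {k m : Type*} [Fintype k] [Fintype m] [Nonempty k]
    (τ : Matrix (k × m) (k × m) ℂ) (h : τ.PosDef) :
    (bptFst τ).PosDef := by
  have : bptFst τ = ∑ a : k, τ.submatrix (fun x : m => (a, x)) (fun x => (a, x)) := by
    ext x y
    simp [bptFst, Matrix.sum_apply]
  rw [this]
  refine Matrix.posDef_sum Finset.univ_nonempty fun c _ => h.submatrix ?_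
  intro x y h
  simpa using h

end tri

end QMCProof

/-- If the logarithm of an invertible tripartite density operator `τ`
decomposes as `log τ = log ρ_AB + log ρ_BC + θ_B` with `θ_B` Hermitian on `H_B`
(everything extended by identities, `ρ_AB = Tr_C τ`, `ρ_BC = Tr_A τ`), then `I_τ(A:C|B) = 0`,
i.e. `τ` is a quantum Markov chain in order A−B−C. -/
theorem log_decomposition_gives_qmc {A B C : Type*} [Fintype A] [Fintype B] [Fintype C]
    [DecidableEq A] [DecidableEq B] [DecidableEq C]
    (τ : Matrix (A × B × C) (A × B × C) ℂ) (hτ : IsDensity τ) (hτinv : IsUnit τ)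
    (θB : Matrix B B ℂ) (hθB : θB.IsHermitian)
    (hlog : matLog τ = extAB (matLog (ptC τ)) + extBC (matLog (ptA τ)) + extB θB) :
    qcmi τ = 0 := by
  classical
  have hne : Nonempty (A × B × C) := by
    by_contra hne
    rw [not_nonempty_iff] at hne
    have := hτ.2
    simp [Matrix.trace] at this
  obtain ⟨a0, b0, c0⟩ := hne
  have : Nonempty A := ⟨a0⟩
  have : Nonempty C := ⟨c0⟩
  have hpd : τ.PosDef := hτ.1.posDef_iff_isUnit.2 hτinv
  have hAB := QMCProof.posDef_ptC τ hpd
  have hBC : (ptA τ).PosDef := QMCProof.posDef_bptFst τ hpd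
  have hB : (ptAC τ).PosDef := by
    rw [← QMCProof.bptFst_ptC]
    exact QMCProof.posDef_bptFst _ hAB
  have hptA : bptFst τ = ptA τ := rfl
  have eE : bptFst (extAB (ptC τ) : Matrix (A × B × C) (A × B × C) ℂ) =
      (ptAC τ).kronecker (1 : Matrix C C ℂ) := by
    rw [QMCProof.bptFst_extAB, QMCProof.bptFst_ptC]
  have lτ := QMCProof.hasLog_matLog τ hpd
  have lE := QMCProof.hasLog_extAB (C := C) _ _ (QMCProof.hasLog_matLog _ hAB)
  have lBC : QMCProof.HasLog (bptFst τ) (matLog (ptA τ)) := QMCProof.hasLog_matLog _ hBC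
  have lB := QMCProof.hasLog_kron (k := C) _ _ (QMCProof.hasLog_matLog _ hB)
  rw [← eE] at lB
  have d1 := QMCProof.dpi _ _ _ _ _ _ lτ lE lBC lB
  have d2 := QMCProof.dpi _ _ _ _ _ _ lE lτ lB lBC
  have hS : qcmi τ = ((ptAC τ * θB).trace).re + ((ptAC τ * matLog (ptAC τ)).trace).re := by
    rw [qcmi, QMCProof.vnEntropy_eq _ hAB, QMCProof.vnEntropy_eq _ hBC,
      QMCProof.vnEntropy_eq _ hB, QMCProof.vnEntropy_eq _ hpd]
    have : ((τ * matLog τ).trace).re = ((ptC τ * matLog (ptC τ)).trace).re +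
        ((ptA τ * matLog (ptA τ)).trace).re + ((ptAC τ * θB).trace).re := by
      rw [hlog, Matrix.mul_add, Matrix.mul_add, Matrix.trace_add, Matrix.trace_add,
        QMCProof.tr_extAB, QMCProof.extB_eq, QMCProof.tr_extBC, QMCProof.tr_extBC, hptA,
        QMCProof.tr_kron, QMCProof.bptSnd_ptA, Complex.add_re, Complex.add_re]
    rw [this]
    ring
  apply le_antisymm
  · have h1 : (extAB (matLog (ptC τ)) - matLog τ : Matrix (A × B × C) (A × B × C) ℂ) =
        - extBC (matLog (ptA τ)) - extB θB := by
      rw [hlog]; abel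
    rw [h1, Matrix.mul_sub, Matrix.mul_sub, Matrix.mul_neg, Matrix.trace_sub, Matrix.trace_sub,
      Matrix.trace_neg, QMCProof.extB_eq, QMCProof.tr_extBC, QMCProof.tr_extBC, eE,
      QMCProof.tr_kron, QMCProof.tr_kron, QMCProof.bptSnd_kron, Matrix.smul_mul, Matrix.smul_mul,
      Matrix.trace_smul, Matrix.trace_smul] at d2
    simp only [Complex.sub_re, Complex.neg_re, smul_eq_mul, Complex.mul_re, Complex.natCast_re, Complex.natCast_im,
      zero_mul, sub_zero] at d2
    have hc : (0 : ℝ) < Fintype.card C := by exact_mod_cast Fintype.card_pos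
    rw [hS]
    by_contra hcon
    push Not at hcon
    have := mul_pos hc hcon
    nlinarith
  · rw [Matrix.mul_sub, Matrix.mul_sub, Matrix.trace_sub, Matrix.trace_sub, QMCProof.tr_extAB,
      QMCProof.tr_kron, hptA, QMCProof.bptSnd_ptA, Complex.sub_re, Complex.sub_re] at d1
    rw [qcmi, QMCProof.vnEntropy_eq _ hAB, QMCProof.vnEntropy_eq _ hBC,
      QMCProof.vnEntropy_eq _ hB, QMCProof.vnEntropy_eq _ hpd]
    linarith
end

section
/- Let (X,Y,Z) be an ordering of the three factors A,B,C, let ρ be an invertible density operator on H_A⊗H_B⊗H_C, and let σ be an invertible density operator on the same space with Tr_Z σ = Tr_Z ρ = ρ_XY and Tr_X σ = Tr_X ρ = ρ_YZ, satisfying I_σ(X:Z|Y) = 0. Then S(ρ || σ) = −[I_ρ(X:Y) + I_ρ(Y:Z)] + S(ρ_A) + S(ρ_B) + S(ρ_C) − S(ρ). Consequently, among such quantum-Markov-chain estimators for the different orderings, the one minimizing the relative entropy to ρ is the one maximizing I_ρ(X:Y) + I_ρ(Y:Z). -/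
open scoped Matrix ComplexOrder

variable {A B C : Type*}

/-- The quantum mutual information between the first two factors of a tripartite state. -/
noncomputable def qmiXY {X Y Z : Type*} [Fintype X] [Fintype Y] [Fintype Z]
    [DecidableEq X] [DecidableEq Y] [DecidableEq Z]
    (ρ : Matrix (X × Y × Z) (X × Y × Z) ℂ) : ℝ :=
  vnEntropy (ptBC ρ) + vnEntropy (ptAC ρ) - vnEntropy (ptC ρ)

/-- The quantum mutual information between the last two factors of a tripartite state. -/
noncomputable def qmiYZ {X Y Z : Type*} [Fintype X] [Fintype Y] [Fintype Z]
    [DecidableEq X] [DecidableEq Y] [DecidableEq Z]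
    (ρ : Matrix (X × Y × Z) (X × Y × Z) ℂ) : ℝ :=
  vnEntropy (ptAC ρ) + vnEntropy (ptAB ρ) - vnEntropy (ptA ρ)

/-! ### Diagonalised Hermitian matrices -/

namespace QMC

open Matrix

/-- `U diag(p) Uᴴ`. -/
noncomputable def dg {n : Type*} [Fintype n] [DecidableEq n] (U : Matrix n n ℂ) (p : n → ℝ) :
    Matrix n n ℂ := U * Matrix.diagonal (fun i => (p i : ℂ)) * Uᴴ

/-- overlap weights. -/
noncomputable def wt {n : Type*} [Fintype n] (U V : Matrix n n ℂ) (i j : n) : ℝ :=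
  Complex.normSq ((Uᴴ * V) i j)

section Gen

variable {n : Type*} [Fintype n] [DecidableEq n]

set_option linter.unusedSectionVars false

theorem trace_diag_mul (d : n → ℂ) (M : Matrix n n ℂ) :
    (Matrix.diagonal d * M).trace = ∑ i, d i * M i i := by
  simp [Matrix.trace, Matrix.diagonal_mul]

theorem trace_dg_mul (U : Matrix n n ℂ) (p : n → ℝ) (M : Matrix n n ℂ) :
    (dg U p * M).trace = ∑ i, (p i : ℂ) * (Uᴴ * M * U) i i := by
  rw [← trace_diag_mul, dg, Matrix.mul_assoc, Matrix.mul_assoc, Matrix.trace_mul_comm]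
  simp only [Matrix.mul_assoc]

theorem trace_dg_mul_dg (U V : Matrix n n ℂ) (a b : n → ℝ) :
    (dg U a * dg V b).trace = ((∑ i, ∑ j, wt U V i j * (a i * b j) : ℝ) : ℂ) := by
  rw [trace_dg_mul]
  push_cast
  refine Finset.sum_congr rfl fun i _ => ?_
  have : Uᴴ * dg V b * U = (Uᴴ * V) * Matrix.diagonal (fun i => (b i : ℂ)) * (Uᴴ * V)ᴴ := by
    simp [dg, Matrix.mul_assoc, Matrix.conjTranspose_mul]
  rw [this, Matrix.mul_apply, Finset.mul_sum]
  refine Finset.sum_congr rfl fun j _ => ?_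
  rw [Matrix.mul_diagonal, Matrix.conjTranspose_apply, wt, ← Complex.mul_conj]
  simp only [Complex.star_def]
  ring

theorem wt_nonneg (U V : Matrix n n ℂ) (i j : n) : 0 ≤ wt U V i j := Complex.normSq_nonneg _

theorem dg_one {U : Matrix n n ℂ} (hU : U * Uᴴ = 1) : dg U (fun _ => 1) = 1 := by
  simp [dg, hU]

theorem dg_mul_dg {U : Matrix n n ℂ} (hU : Uᴴ * U = 1) (a b : n → ℝ) :
    dg U a * dg U b = dg U (fun i => a i * b i) := by
  have : dg U a * dg U b = U * Matrix.diagonal (fun i => (a i : ℂ)) * (Uᴴ * U) *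
      Matrix.diagonal (fun i => (b i : ℂ)) * Uᴴ := by simp only [dg, Matrix.mul_assoc]
  rw [this, hU, Matrix.mul_one, Matrix.mul_assoc U, Matrix.diagonal_mul_diagonal]
  simp [dg]

theorem trace_dg {U : Matrix n n ℂ} (hU : Uᴴ * U = 1) (p : n → ℝ) :
    (dg U p).trace = ((∑ i, p i : ℝ) : ℂ) := by
  have := trace_dg_mul U p 1
  rw [Matrix.mul_one, Matrix.mul_one, hU] at this
  simpa using this

/-- variational functional -/
noncomputable def J (t : ℝ) (ρ σ X : Matrix n n ℂ) : ℝ :=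
  2 * (ρ * X).trace.re - (σ * (X * Xᴴ)).trace.re - t * (ρ * (Xᴴ * X)).trace.re

noncomputable def Q (t : ℝ) (U V : Matrix n n ℂ) (p q : n → ℝ) : ℝ :=
  ∑ i, ∑ j, wt U V i j * ((p i) ^ 2 / (q j + t * p i))

theorem J_eq {U V : Matrix n n ℂ} (hU : U * Uᴴ = 1) (hV : V * Vᴴ = 1) (p q : n → ℝ) (t : ℝ)
    (X : Matrix n n ℂ) :
    J t (dg U p) (dg V q) X = ∑ i, ∑ j, (2 * (p i * ((Uᴴ * V) i j * (Vᴴ * X * U) j i).re)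
      - (q j + t * p i) * Complex.normSq ((Vᴴ * X * U) j i)) := by
  set Y := Vᴴ * X * U with hY
  have h1 : Uᴴ * X * U = (Uᴴ * V) * Y := by
    rw [hY]
    calc Uᴴ * X * U = Uᴴ * 1 * X * U := by simp
      _ = _ := by rw [← hV]; simp only [Matrix.mul_assoc]
  have h2 : Vᴴ * (X * Xᴴ) * V = Y * Yᴴ := by
    rw [hY]
    calc Vᴴ * (X * Xᴴ) * V = Vᴴ * (X * 1 * Xᴴ) * V := by simp
      _ = _ := by
        rw [← hU]; simp only [Matrix.mul_assoc, Matrix.conjTranspose_mul,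
          Matrix.conjTranspose_conjTranspose]
  have h3 : Uᴴ * (Xᴴ * X) * U = Yᴴ * Y := by
    rw [hY]
    calc Uᴴ * (Xᴴ * X) * U = Uᴴ * (Xᴴ * 1 * X) * U := by simp
      _ = _ := by
        rw [← hV]; simp only [Matrix.mul_assoc, Matrix.conjTranspose_mul,
          Matrix.conjTranspose_conjTranspose]
  have e1 : (dg U p * X).trace.re = ∑ i, ∑ j, p i * ((Uᴴ * V) i j * Y j i).re := by
    rw [trace_dg_mul, h1, Complex.re_sum]
    refine Finset.sum_congr rfl fun i _ => ?_
    rw [Complex.re_ofReal_mul, Matrix.mul_apply, Complex.re_sum, Finset.mul_sum]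
  have e2 : (dg V q * (X * Xᴴ)).trace.re = ∑ i, ∑ j, q j * Complex.normSq (Y j i) := by
    rw [trace_dg_mul, h2, Complex.re_sum, Finset.sum_comm]
    refine Finset.sum_congr rfl fun i _ => ?_
    rw [Complex.re_ofReal_mul, Matrix.mul_apply, Complex.re_sum, Finset.mul_sum]
    refine Finset.sum_congr rfl fun j _ => ?_
    rw [Matrix.conjTranspose_apply, Complex.star_def, Complex.mul_conj, Complex.ofReal_re]
  have e3 : (dg U p * (Xᴴ * X)).trace.re = ∑ i, ∑ j, p i * Complex.normSq (Y j i) := by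
    rw [trace_dg_mul, h3, Complex.re_sum]
    refine Finset.sum_congr rfl fun i _ => ?_
    rw [Complex.re_ofReal_mul, Matrix.mul_apply, Complex.re_sum, Finset.mul_sum]
    refine Finset.sum_congr rfl fun j _ => ?_
    rw [Matrix.conjTranspose_apply, Complex.star_def, ← Complex.normSq_eq_conj_mul_self,
      Complex.ofReal_re]
  rw [J, e1, e2, e3]
  simp only [Finset.mul_sum, ← Finset.sum_sub_distrib]
  refine Finset.sum_congr rfl fun i _ => Finset.sum_congr rfl fun j _ => ?_
  ring

theorem J_le_Q {U V : Matrix n n ℂ} (hU : U * Uᴴ = 1) (hV : V * Vᴴ = 1) {p q : n → ℝ}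
    (hp : ∀ i, 0 < p i) (hq : ∀ i, 0 < q i) {t : ℝ} (ht : 0 ≤ t) (X : Matrix n n ℂ) :
    J t (dg U p) (dg V q) X ≤ Q t U V p q := by
  rw [J_eq hU hV, Q]
  refine Finset.sum_le_sum fun i _ => Finset.sum_le_sum fun j _ => ?_
  have hc : 0 < q j + t * p i := by have := hq j; have := mul_nonneg ht (hp i).le; linarith
  rw [wt]
  generalize (Uᴴ * V) i j = w
  generalize (Vᴴ * X * U) j i = y
  generalize q j + t * p i = c at hc
  generalize p i = a
  rw [Complex.mul_re, Complex.normSq_apply, Complex.normSq_apply, ← sub_nonneg]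
  have : (w.re * w.re + w.im * w.im) * (a ^ 2 / c) - (2 * (a * (w.re * y.re - w.im * y.im)) -
      c * (y.re * y.re + y.im * y.im)) = ((a * w.re - c * y.re)^2 + (a * w.im + c * y.im)^2) / c := by
    field_simp
    ring
  rw [this]
  positivity

theorem exists_J_eq_Q {U V : Matrix n n ℂ} (hU : U * Uᴴ = 1) (hV : V * Vᴴ = 1) {p q : n → ℝ}
    (hp : ∀ i, 0 < p i) (hq : ∀ i, 0 < q i) {t : ℝ} (ht : 0 ≤ t) :
    ∃ X, J t (dg U p) (dg V q) X = Q t U V p q := by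
  have hU' : Uᴴ * U = 1 := mul_eq_one_comm.mp hU
  have hV' : Vᴴ * V = 1 := mul_eq_one_comm.mp hV
  let Y : Matrix n n ℂ := fun j i => ((p i / (q j + t * p i) : ℝ) : ℂ) * star ((Uᴴ * V) i j)
  refine ⟨V * Y * Uᴴ, ?_⟩
  have hY : Vᴴ * (V * Y * Uᴴ) * U = Y := by
    calc Vᴴ * (V * Y * Uᴴ) * U = (Vᴴ * V) * Y * (Uᴴ * U) := by simp only [Matrix.mul_assoc]
      _ = Y := by simp [hU', hV']
  rw [J_eq hU hV, Q, hY]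
  refine Finset.sum_congr rfl fun i _ => Finset.sum_congr rfl fun j _ => ?_
  have hc : 0 < q j + t * p i := by have := hq j; have := mul_nonneg ht (hp i).le; linarith
  simp only [Y, wt]
  generalize (Uᴴ * V) i j = w
  generalize q j + t * p i = c at hc
  generalize p i = a
  simp only [Complex.star_def, Complex.mul_re, Complex.normSq_apply, Complex.mul_im,
    Complex.conj_re, Complex.conj_im, Complex.ofReal_re, Complex.ofReal_im]
  field_simp
  ring

/-- relative entropy in diagonalised form -/
noncomputable def R (U V : Matrix n n ℂ) (p q : n → ℝ) : ℝ :=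
  ∑ i, ∑ j, wt U V i j * (p i * Real.log (p i) - p i * Real.log (q j))

noncomputable def Phi (U V : Matrix n n ℂ) (p q : n → ℝ) (T : ℝ) : ℝ :=
  ∑ i, ∑ j, wt U V i j * (p i * (Real.log (q j + T * p i) - Real.log (q j)))

theorem Phi_zero (U V : Matrix n n ℂ) (p q : n → ℝ) : Phi U V p q 0 = 0 := by
  simp [Phi]

theorem Phi_hasDerivAt (U V : Matrix n n ℂ) {p q : n → ℝ}
    (hp : ∀ i, 0 < p i) (hq : ∀ i, 0 < q i) {t : ℝ} (ht : 0 ≤ t) :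
    HasDerivAt (Phi U V p q) (Q t U V p q) t := by
  unfold Phi Q
  refine HasDerivAt.fun_sum fun i _ => HasDerivAt.fun_sum fun j _ => ?_
  have hc : 0 < q j + t * p i := by have := hq j; have := mul_nonneg ht (hp i).le; linarith
  have h1 : HasDerivAt (fun T : ℝ => q j + T * p i) (p i) t := by
    simpa using ((hasDerivAt_id t).mul_const (p i)).const_add (q j)
  have h2 := (((h1.log hc.ne').sub_const (Real.log (q j))).const_mul (p i)).const_mul (wt U V i j)
  have e : wt U V i j * (p i ^ 2 / (q j + t * p i)) =
      wt U V i j * (p i * (p i / (q j + t * p i))) := by ring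
  rw [e]
  exact h2

theorem sum_wt_right {U V : Matrix n n ℂ} (hU : U * Uᴴ = 1) (hV : V * Vᴴ = 1) (a : n → ℝ) :
    ∑ i, ∑ j, wt U V i j * a i = ∑ i, a i := by
  have h := trace_dg_mul_dg U V a (fun _ => 1)
  rw [dg_one hV, Matrix.mul_one, trace_dg (mul_eq_one_comm.mp hU)] at h
  have := Complex.ofReal_injective h
  simpa using this.symm

theorem sum_wt_left {U V : Matrix n n ℂ} (hU : U * Uᴴ = 1) (hV : V * Vᴴ = 1) (b : n → ℝ) :
    ∑ i, ∑ j, wt U V i j * b j = ∑ i, b i := by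
  have h := trace_dg_mul_dg U V (fun _ => 1) b
  rw [dg_one hU, Matrix.one_mul, trace_dg (mul_eq_one_comm.mp hV)] at h
  have := Complex.ofReal_injective h
  simpa using this.symm

theorem Phi_tendsto {U V : Matrix n n ℂ} (hU : U * Uᴴ = 1) (hV : V * Vᴴ = 1) {p q : n → ℝ}
    (hp : ∀ i, 0 < p i) (hq : ∀ i, 0 < q i) :
    Filter.Tendsto (fun T => Phi U V p q T - (∑ i, p i) * Real.log T) Filter.atTop
      (nhds (R U V p q)) := by
  have key : Filter.Tendsto (fun T : ℝ => ∑ i, ∑ j, wt U V i j *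
      (p i * Real.log (q j * T⁻¹ + p i) - p i * Real.log (q j))) Filter.atTop
      (nhds (R U V p q)) := by
    unfold R
    refine tendsto_finsetSum _ fun i _ => tendsto_finsetSum _ fun j _ => ?_
    refine Filter.Tendsto.const_mul _ (Filter.Tendsto.sub_const (Filter.Tendsto.const_mul _ ?_) _)
    have h : Filter.Tendsto (fun T : ℝ => q j * T⁻¹ + p i) Filter.atTop (nhds (p i)) := by
      simpa using (tendsto_inv_atTop_zero.const_mul (q j)).add_const (p i)
    exact h.log (hp i).ne'
  refine key.congr' ?_
  filter_upwards [Filter.eventually_gt_atTop 0] with T hT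
  rw [← sum_wt_right hU hV p, Phi, Finset.sum_mul, ← Finset.sum_sub_distrib]
  refine Finset.sum_congr rfl fun i _ => ?_
  rw [Finset.sum_mul, ← Finset.sum_sub_distrib]
  refine Finset.sum_congr rfl fun j _ => ?_
  have : q j * T⁻¹ + p i = (q j + T * p i) / T := by field_simp
  have hc : 0 < q j + T * p i := by have := hq j; have := mul_pos hT (hp i); linarith
  rw [this, Real.log_div hc.ne' hT.ne']
  ring

/-- chi-square bound -/
theorem R_le {U V : Matrix n n ℂ} (hU : U * Uᴴ = 1) (hV : V * Vᴴ = 1) {p q : n → ℝ}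
    (hp : ∀ i, 0 < p i) (hq : ∀ i, 0 < q i) :
    R U V p q ≤ (dg U p * dg U p * dg V (fun i => (q i)⁻¹)).trace.re - ∑ i, p i := by
  rw [dg_mul_dg (mul_eq_one_comm.mp hU), trace_dg_mul_dg, Complex.ofReal_re,
    ← sum_wt_right hU hV p, R]
  simp only [← Finset.sum_sub_distrib]
  refine Finset.sum_le_sum fun i _ => Finset.sum_le_sum fun j _ => ?_
  rw [← mul_sub, ← mul_sub]
  refine mul_le_mul_of_nonneg_left ?_ (wt_nonneg U V i j)
  have h := Real.log_le_sub_one_of_pos (div_pos (hp i) (hq j))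
  rw [Real.log_div (hp i).ne' (hq j).ne'] at h
  have := mul_le_mul_of_nonneg_left h (hp i).le
  refine this.trans (le_of_eq ?_)
  rw [div_eq_mul_inv]; ring

theorem R_eq {U V : Matrix n n ℂ} (hU : U * Uᴴ = 1) (hV : V * Vᴴ = 1) (p q : n → ℝ) :
    R U V p q = ∑ i, p i * Real.log (p i) -
      (dg U p * dg V (fun i => Real.log (q i))).trace.re := by
  rw [trace_dg_mul_dg, Complex.ofReal_re, ← sum_wt_right hU hV, R]
  simp only [← Finset.sum_sub_distrib, mul_sub]

end Gen

/-- monotonicity of relative entropy, given that every value of the small functional is a value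
of the big functional. -/
theorem R_mono {n m : Type*} [Fintype n] [DecidableEq n] [Fintype m] [DecidableEq m]
    {U V : Matrix n n ℂ} (hU : U * Uᴴ = 1) (hV : V * Vᴴ = 1) {p q : n → ℝ}
    (hp : ∀ i, 0 < p i) (hq : ∀ i, 0 < q i)
    {U' V' : Matrix m m ℂ} (hU' : U' * U'ᴴ = 1) (hV' : V' * V'ᴴ = 1) {p' q' : m → ℝ}
    (hp' : ∀ i, 0 < p' i) (hq' : ∀ i, 0 < q' i)
    (hsum : ∑ i, p i = ∑ i, p' i)
    (hJ : ∀ t X, ∃ X', J t (dg U' p') (dg V' q') X = J t (dg U p) (dg V q) X') :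
    R U' V' p' q' ≤ R U V p q := by
  have hQ : ∀ t, 0 ≤ t → Q t U' V' p' q' ≤ Q t U V p q := by
    intro t ht
    obtain ⟨X, hX⟩ := exists_J_eq_Q hU' hV' hp' hq' ht
    obtain ⟨X', hX'⟩ := hJ t X
    rw [← hX, hX']
    exact J_le_Q hU hV hp hq ht X'
  have hd : ∀ t, 0 ≤ t → HasDerivAt (fun T => Phi U V p q T - Phi U' V' p' q' T)
      (Q t U V p q - Q t U' V' p' q') t := fun t ht =>
    (Phi_hasDerivAt U V hp hq ht).sub (Phi_hasDerivAt U' V' hp' hq' ht)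
  have hm : MonotoneOn (fun T => Phi U V p q T - Phi U' V' p' q' T) (Set.Ici 0) := by
    refine monotoneOn_of_deriv_nonneg (convex_Ici 0) ?_ ?_ ?_
    · exact fun t ht => (hd t ht).continuousAt.continuousWithinAt
    · rw [interior_Ici]
      exact fun t ht => (hd t (le_of_lt ht)).differentiableAt.differentiableWithinAt
    · rw [interior_Ici]
      intro t ht
      rw [(hd t (le_of_lt ht)).deriv]
      exact sub_nonneg.mpr (hQ t (le_of_lt ht))
  refine le_of_tendsto_of_tendsto (Phi_tendsto hU' hV' hp' hq') (Phi_tendsto hU hV hp hq) ?_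
  filter_upwards [Filter.eventually_ge_atTop 0] with T hT
  have := hm (Set.mem_Ici.mpr le_rfl) hT hT
  simp only [Phi_zero] at this
  rw [hsum]
  linarith

theorem exists_dg {n : Type*} [Fintype n] [DecidableEq n] {M : Matrix n n ℂ} (hM : M.PosDef) :
    ∃ (U : Matrix n n ℂ) (p : n → ℝ), U * Uᴴ = 1 ∧ (∀ i, 0 < p i) ∧ M = dg U p ∧
      vnEntropy M = -∑ i, p i * Real.log (p i) ∧ matLog M = dg U (fun i => Real.log (p i)) := by
  have h := hM.isHermitian
  refine ⟨h.eigenvectorUnitary, h.eigenvalues, ?_, hM.eigenvalues_pos, ?_, ?_, ?_⟩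
  · have := Unitary.mul_star_self_of_mem h.eigenvectorUnitary.2
    exact this
  · exact h.spectral_theorem
  · rw [vnEntropy, dif_pos h]
  · rw [matLog, matFun, dif_pos h]
    rfl

theorem trace_mul_matLog {n : Type*} [Fintype n] [DecidableEq n] {M : Matrix n n ℂ}
    (hM : M.PosDef) : (M * matLog M).trace.re = -vnEntropy M := by
  obtain ⟨U, p, hU, hp, hd, hS, hL⟩ := exists_dg hM
  rw [hL, hS]
  nth_rw 1 [hd]
  rw [dg_mul_dg (mul_eq_one_comm.mp hU), trace_dg (mul_eq_one_comm.mp hU), Complex.ofReal_re]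
  simp

section Tri

variable {X Y Z : Type*} [Fintype X] [Fintype Y] [Fintype Z]
    [DecidableEq X] [DecidableEq Y] [DecidableEq Z]

set_option linter.unusedSectionVars false

theorem trace_mul_extBC (ρ : Matrix (X × Y × Z) (X × Y × Z) ℂ) (M : Matrix (Y × Z) (Y × Z) ℂ) :
    (ρ * extBC M).trace = (ptA ρ * M).trace := by
  simp only [Matrix.trace, Matrix.diag, Matrix.mul_apply, ptA, extBC,
    Fintype.sum_prod_type (α₁ := X), Finset.sum_mul]
  simp only [ite_mul, one_mul, zero_mul, mul_ite, mul_zero]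
  rw [Finset.sum_comm]
  refine Finset.sum_congr rfl fun y _ => ?_
  rw [Finset.sum_comm]
  simp only [Finset.sum_comm (s := (Finset.univ : Finset (Y × Z))) (t := (Finset.univ : Finset X))]
  refine Finset.sum_congr rfl fun x _ => ?_
  rw [Finset.sum_comm]
  simp

theorem extBC_mul (M N : Matrix (Y × Z) (Y × Z) ℂ) :
    (extBC M * extBC N : Matrix (X × Y × Z) (X × Y × Z) ℂ) = extBC (M * N) := by
  ext a b
  simp [Matrix.mul_apply, extBC, Fintype.sum_prod_type (α₁ := X), Finset.mul_sum]

theorem extBC_conjTranspose (M : Matrix (Y × Z) (Y × Z) ℂ) :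
    ((extBC M)ᴴ : Matrix (X × Y × Z) (X × Y × Z) ℂ) = extBC Mᴴ := by
  ext a b
  simp only [Matrix.conjTranspose_apply, extBC, star_mul']
  congr 1
  by_cases h : a.1 = b.1
  · simp [h]
  · simp [h, Ne.symm h]

theorem J_ptA (t : ℝ) (ρ σ : Matrix (X × Y × Z) (X × Y × Z) ℂ) (M : Matrix (Y × Z) (Y × Z) ℂ) :
    J t (ptA ρ) (ptA σ) M = J t ρ σ (extBC M) := by
  simp only [J, extBC_conjTranspose, extBC_mul, trace_mul_extBC]

theorem trace_ptA (ρ : Matrix (X × Y × Z) (X × Y × Z) ℂ) : (ptA ρ).trace = ρ.trace := by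
  simp only [Matrix.trace, Matrix.diag, ptA, Fintype.sum_prod_type (α₁ := X)]
  rw [Finset.sum_comm]

theorem trace_mul_extAB (ρ : Matrix (X × Y × Z) (X × Y × Z) ℂ) (M : Matrix (X × Y) (X × Y) ℂ) :
    (ρ * extAB M).trace = (ptC ρ * M).trace := by
  simp only [Matrix.trace, Matrix.diag, Matrix.mul_apply, ptC, extAB,
    Fintype.sum_prod_type, Finset.sum_mul]
  simp only [mul_ite, mul_one, mul_zero, Finset.sum_ite_eq', Finset.mem_univ, if_true]
  refine Finset.sum_congr rfl fun x _ => Finset.sum_congr rfl fun y _ => ?_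
  rw [Finset.sum_comm]
  refine Finset.sum_congr rfl fun x' _ => ?_
  rw [Finset.sum_comm]
  try simp

/-- `M ⊗ 1` on the last two factors. -/
noncomputable def extY (M : Matrix Y Y ℂ) : Matrix (Y × Z) (Y × Z) ℂ :=
  fun x y => M x.1 y.1 * (if x.2 = y.2 then 1 else 0)

theorem trace_mul_extY (ρ : Matrix (X × Y × Z) (X × Y × Z) ℂ) (M : Matrix Y Y ℂ) :
    (ptA ρ * extY M).trace = (ptAC ρ * M).trace := by
  simp only [Matrix.trace, Matrix.diag, Matrix.mul_apply, ptA, ptAC, extY,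
    Fintype.sum_prod_type, Finset.sum_mul]
  simp only [mul_ite, mul_one, mul_zero, Finset.sum_ite_eq', Finset.mem_univ, if_true]
  refine Finset.sum_congr rfl fun y _ => ?_
  rw [Finset.sum_comm]
  refine Finset.sum_congr rfl fun y' _ => ?_
  rw [Finset.sum_comm' (s' := fun _ => Finset.univ) (t' := Finset.univ) (by simp)]
  try simp
  try rw [Finset.sum_comm]

theorem ptA_extAB (ρ : Matrix (X × Y × Z) (X × Y × Z) ℂ) :
    ptA (extAB (ptC ρ)) = (extY (ptAC ρ) : Matrix (Y × Z) (Y × Z) ℂ) := by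
  ext a b
  simp only [ptA, extAB, ptC, extY, ptAC, Finset.sum_mul]

theorem extAB_mul (M N : Matrix (X × Y) (X × Y) ℂ) :
    (extAB M * extAB N : Matrix (X × Y × Z) (X × Y × Z) ℂ) = extAB (M * N) := by
  ext a b
  simp [Matrix.mul_apply, extAB, Fintype.sum_prod_type, Finset.sum_mul]

theorem extAB_conjTranspose (M : Matrix (X × Y) (X × Y) ℂ) :
    ((extAB M)ᴴ : Matrix (X × Y × Z) (X × Y × Z) ℂ) = extAB Mᴴ := by
  ext a b
  simp only [Matrix.conjTranspose_apply, extAB, star_mul']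
  congr 1
  by_cases h : a.2.2 = b.2.2
  · simp [h]
  · simp [h, Ne.symm h]

theorem extAB_one : (extAB 1 : Matrix (X × Y × Z) (X × Y × Z) ℂ) = 1 := by
  ext ⟨a, b, c⟩ ⟨a', b', c'⟩
  simp only [extAB, Matrix.one_apply, Prod.mk.injEq]
  by_cases h1 : a = a' <;> by_cases h2 : b = b' <;> by_cases h3 : c = c' <;> simp [h1, h2, h3]

theorem extAB_diagonal (d : X × Y → ℂ) : (extAB (Matrix.diagonal d) :
    Matrix (X × Y × Z) (X × Y × Z) ℂ) = Matrix.diagonal (fun x => d (x.1, x.2.1)) := by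
  ext ⟨a, b, c⟩ ⟨a', b', c'⟩
  simp only [extAB, Matrix.diagonal_apply, Prod.mk.injEq]
  by_cases h1 : a = a' <;> by_cases h2 : b = b' <;> by_cases h3 : c = c' <;> simp [h1, h2, h3]

theorem extY_mul (M N : Matrix Y Y ℂ) :
    (extY M * extY N : Matrix (Y × Z) (Y × Z) ℂ) = extY (M * N) := by
  ext a b
  simp [Matrix.mul_apply, extY, Fintype.sum_prod_type, Finset.sum_mul]

theorem extY_conjTranspose (M : Matrix Y Y ℂ) :
    ((extY M)ᴴ : Matrix (Y × Z) (Y × Z) ℂ) = extY Mᴴ := by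
  ext a b
  simp only [Matrix.conjTranspose_apply, extY, star_mul']
  congr 1
  by_cases h : a.2 = b.2
  · simp [h]
  · simp [h, Ne.symm h]

theorem extY_one : (extY 1 : Matrix (Y × Z) (Y × Z) ℂ) = 1 := by
  ext ⟨b, c⟩ ⟨b', c'⟩
  simp only [extY, Matrix.one_apply, Prod.mk.injEq]
  by_cases h2 : b = b' <;> by_cases h3 : c = c' <;> simp [h2, h3]

theorem extY_diagonal (d : Y → ℂ) : (extY (Matrix.diagonal d) :
    Matrix (Y × Z) (Y × Z) ℂ) = Matrix.diagonal (fun x => d x.1) := by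
  ext ⟨b, c⟩ ⟨b', c'⟩
  simp only [extY, Matrix.diagonal_apply, Prod.mk.injEq]
  by_cases h2 : b = b' <;> by_cases h3 : c = c' <;> simp [h2, h3]

theorem dg_extAB (U : Matrix (X × Y) (X × Y) ℂ) (p : X × Y → ℝ) :
    (dg (extAB U) (fun x => p (x.1, x.2.1)) : Matrix (X × Y × Z) (X × Y × Z) ℂ) =
      extAB (dg U p) := by
  rw [dg, dg, ← extAB_mul, ← extAB_mul, extAB_diagonal, extAB_conjTranspose]

theorem dg_extY (U : Matrix Y Y ℂ) (p : Y → ℝ) :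
    (dg (extY U) (fun x => p x.1) : Matrix (Y × Z) (Y × Z) ℂ) = extY (dg U p) := by
  rw [dg, dg, ← extY_mul, ← extY_mul, extY_diagonal, extY_conjTranspose]

theorem ptC_posDef [Nonempty Z] {τ : Matrix (X × Y × Z) (X × Y × Z) ℂ} (h : τ.PosDef) :
    (ptC τ).PosDef := by
  have : ptC τ = ∑ c : Z, τ.submatrix (fun x : X × Y => (x.1, x.2, c))
      (fun x : X × Y => (x.1, x.2, c)) := by
    ext a b
    simp [ptC, Matrix.sum_apply]
  rw [this]
  refine Matrix.posDef_sum Finset.univ_nonempty fun c _ => h.submatrix ?_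
  rintro ⟨a, b⟩ ⟨a', b'⟩ hh
  simpa using hh

theorem ptA_posDef [Nonempty X] {τ : Matrix (X × Y × Z) (X × Y × Z) ℂ} (h : τ.PosDef) :
    (ptA τ).PosDef := by
  have : ptA τ = ∑ a : X, τ.submatrix (fun x : Y × Z => (a, x))
      (fun x : Y × Z => (a, x)) := by
    ext a b
    simp [ptA, Matrix.sum_apply]
  rw [this]
  refine Matrix.posDef_sum Finset.univ_nonempty fun c _ => h.submatrix ?_
  rintro ⟨a, b⟩ ⟨a', b'⟩ hh
  simpa using hh

theorem ptAC_eq (τ : Matrix (X × Y × Z) (X × Y × Z) ℂ) :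
    ptAC τ = ∑ a : X, (ptC τ).submatrix (fun b : Y => (a, b)) (fun b : Y => (a, b)) := by
  ext a b
  simp [ptAC, ptC, Matrix.sum_apply]

theorem ptAC_posDef [Nonempty X] [Nonempty Z] {τ : Matrix (X × Y × Z) (X × Y × Z) ℂ}
    (h : τ.PosDef) : (ptAC τ).PosDef := by
  rw [ptAC_eq]
  refine Matrix.posDef_sum Finset.univ_nonempty fun c _ => (ptC_posDef h).submatrix ?_
  intro a b hh
  simpa using hh

/-- Strong subadditivity for positive definite operators. -/
theorem ssa [Nonempty X] [Nonempty Z] {τ : Matrix (X × Y × Z) (X × Y × Z) ℂ}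
    (h : τ.PosDef) : 0 ≤ qcmi τ := by
  obtain ⟨U, p, hU, hp, hd, hS, -⟩ := exists_dg h
  obtain ⟨V, q, hV, hq, hd1, hS1, hL1⟩ := exists_dg (ptC_posDef h)
  obtain ⟨U', p', hU', hp', hd2, hS2, -⟩ := exists_dg (ptA_posDef h)
  obtain ⟨V', q', hV', hq', hd3, hS3, hL3⟩ := exists_dg (ptAC_posDef h)
  have hVe : (extAB V * (extAB V)ᴴ : Matrix (X × Y × Z) (X × Y × Z) ℂ) = 1 := by
    rw [extAB_conjTranspose, extAB_mul, hV, extAB_one]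
  have hVe' : (extY V' * (extY V')ᴴ : Matrix (Y × Z) (Y × Z) ℂ) = 1 := by
    rw [extY_conjTranspose, extY_mul, hV', extY_one]
  have hsum : ∑ i, p i = ∑ i, p' i := by
    have := trace_ptA τ
    rw [hd2, trace_dg (mul_eq_one_comm.mp hU')] at this
    nth_rw 1 [hd] at this
    rw [trace_dg (mul_eq_one_comm.mp hU)] at this
    exact (Complex.ofReal_injective this).symm
  have key := R_mono hU hVe hp (q := fun x => q (x.1, x.2.1)) (fun x => hq _) hU' hVe' hp'
    (q' := fun x => q' x.1) (fun x => hq' _) hsum (by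
      intro t M
      refine ⟨extBC M, ?_⟩
      rw [dg_extAB, dg_extY, ← hd, ← hd1, ← hd2, ← hd3, ← ptA_extAB, J_ptA])
  rw [R_eq hU hVe, R_eq hU' hVe', ← hd, ← hd2,
    dg_extAB V (fun i => Real.log (q i)), dg_extY V' (fun i => Real.log (q' i)), ← hL1, ← hL3,
    trace_mul_extAB, trace_mul_extY, trace_mul_matLog (ptC_posDef h),
    trace_mul_matLog (ptAC_posDef h)] at key
  rw [qcmi]
  linarith

end Tri

theorem exists_dg_herm {n : Type*} [Fintype n] [DecidableEq n] {M : Matrix n n ℂ}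
    (h : M.IsHermitian) : ∃ (U : Matrix n n ℂ) (p : n → ℝ), U * Uᴴ = 1 ∧ M = dg U p := by
  refine ⟨h.eigenvectorUnitary, h.eigenvalues, ?_, ?_⟩
  · have := Unitary.mul_star_self_of_mem h.eigenvectorUnitary.2
    exact this
  · exact h.spectral_theorem

theorem dg_posSemidef {n : Type*} [Fintype n] [DecidableEq n] (U : Matrix n n ℂ) {p : n → ℝ}
    (hp : ∀ i, 0 ≤ p i) : (dg U p).PosSemidef := by
  refine Matrix.PosSemidef.mul_mul_conjTranspose_same (Matrix.posSemidef_diagonal_iff.mpr ?_) U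
  intro i
  exact_mod_cast hp i

theorem dg_add_const {n : Type*} [Fintype n] [DecidableEq n] {U : Matrix n n ℂ}
    (hU : U * Uᴴ = 1) (p : n → ℝ) (K : ℝ) :
    dg U (fun i => p i + K) = dg U p + (K : ℂ) • 1 := by
  have : (Matrix.diagonal (fun i => ((p i + K : ℝ) : ℂ)) : Matrix n n ℂ) =
      Matrix.diagonal (fun i => (p i : ℂ)) + (K : ℂ) • 1 := by
    ext i j
    by_cases hij : i = j
    · subst hij; simp
    · simp [hij]
  rw [dg, this, Matrix.mul_add, Matrix.add_mul, dg]
  simp [hU]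

theorem posDef_perturb {n : Type*} [Fintype n] [DecidableEq n] [Nonempty n]
    {σ H : Matrix n n ℂ} (hσ : σ.PosDef) (hH : H.IsHermitian) :
    ∃ ε : ℝ, 0 < ε ∧ ∀ s : ℝ, 0 ≤ s → s < ε → (σ + (s : ℂ) • H).PosDef := by
  obtain ⟨U, p, hU, hp, hd, -, -⟩ := exists_dg hσ
  obtain ⟨V, q, hV, hd'⟩ := exists_dg_herm hH
  obtain ⟨i0, hi0⟩ := Finite.exists_min p
  set K : ℝ := 1 + ∑ i, |q i| with hK
  have hKpos : 0 < K := by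
    have : 0 ≤ ∑ i, |q i| := Finset.sum_nonneg fun i _ => abs_nonneg _
    linarith
  have h1 : (σ + ((-(p i0) : ℝ) : ℂ) • 1).PosSemidef := by
    rw [hd, ← dg_add_const hU]
    refine dg_posSemidef U fun i => ?_
    have := hi0 i
    linarith
  have h2 : (H + (K : ℂ) • 1).PosSemidef := by
    rw [hd', ← dg_add_const hV]
    refine dg_posSemidef V fun i => ?_
    have h3 := Finset.single_le_sum (f := fun i => |q i|) (fun i _ => abs_nonneg _)
      (Finset.mem_univ i)
    have h4 := neg_abs_le (q i)
    linarith
  refine ⟨p i0 / K, div_pos (hp i0) hKpos, fun s hs hs' => ?_⟩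
  rw [lt_div_iff₀ hKpos] at hs'
  have h5 : (((p i0 - s * K : ℝ) : ℂ) • (1 : Matrix n n ℂ)).PosDef :=
    Matrix.PosDef.one.smul (by exact_mod_cast sub_pos.mpr hs')
  have h6 : ((s : ℂ) • (H + (K : ℂ) • 1)).PosSemidef := h2.smul (by exact_mod_cast hs)
  have h7 := h5.add_posSemidef (h1.add h6)
  convert h7 using 1
  push_cast
  module

section Final

variable {X Y Z : Type*} [Fintype X] [Fintype Y] [Fintype Z]
    [DecidableEq X] [DecidableEq Y] [DecidableEq Z]

theorem trace_log_nonneg [Nonempty X] [Nonempty Y] [Nonempty Z]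
    {σ H : Matrix (X × Y × Z) (X × Y × Z) ℂ} (hσ : σ.PosDef) (hH : H.IsHermitian)
    (hC : ptC H = 0) (hA : ptA H = 0) (hq : qcmi σ = 0) :
    0 ≤ (H * matLog σ).trace.re := by
  obtain ⟨ε, hε, hpos⟩ := posDef_perturb hσ hH
  obtain ⟨V, q, hV, hqpos, hd, hS, hL⟩ := exists_dg hσ
  have hV' := mul_eq_one_comm.mp hV
  set G := dg V (fun i => (q i)⁻¹) with hG
  have hσG : σ * G = 1 := by
    rw [hd, hG, dg_mul_dg hV']
    simp only [mul_inv_cancel₀ (hqpos _).ne']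
    exact dg_one hV
  have hGσ : G * σ = 1 := mul_eq_one_comm.mp hσG
  have htr : H.trace = 0 := by rw [← trace_ptA, hA]; simp
  set a := (H * matLog σ).trace.re with ha
  set c := (H * H * G).trace.re with hc
  have main : ∀ s : ℝ, 0 < s → s < ε → -a ≤ s * c := by
    intro s hs hs'
    have hτ := hpos s hs.le hs'
    set τ := σ + (s : ℂ) • H with hτd
    have eC : ptC τ = ptC σ := by
      ext x y
      have := congrFun (congrFun hC x) y
      simp only [ptC, Matrix.zero_apply] at this
      simp [ptC, hτd, Finset.sum_add_distrib, ← Finset.mul_sum, this]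
    have eA : ptA τ = ptA σ := by
      ext x y
      have := congrFun (congrFun hA x) y
      simp only [ptA, Matrix.zero_apply] at this
      simp [ptA, hτd, Finset.sum_add_distrib, ← Finset.mul_sum, this]
    have hssa := ssa hτ
    rw [qcmi, ptAC_eq, eC, eA, ← ptAC_eq] at hssa
    rw [qcmi] at hq
    obtain ⟨U, p, hU, hp, hdτ, hSτ, -⟩ := exists_dg hτ
    have hR := R_le hU hV hp hqpos
    rw [R_eq hU hV, ← hL, ← hdτ, ← hG] at hR
    have hsum : ∑ i, p i = σ.trace.re := by
      have h1 : τ.trace = σ.trace := by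
        rw [hτd, Matrix.trace_add, Matrix.trace_smul, htr]; simp
      rw [← h1, hdτ, trace_dg (mul_eq_one_comm.mp hU), Complex.ofReal_re]
    have hquad : (τ * τ * G).trace.re = σ.trace.re + s ^ 2 * c := by
      have e : τ * τ * G = σ * (σ * G) + (s : ℂ) • (σ * (H * G)) + (s : ℂ) • (H * (σ * G)) +
          ((s ^ 2 : ℝ) : ℂ) • (H * H * G) := by
        rw [hτd]
        simp only [Matrix.add_mul, Matrix.mul_add, Matrix.smul_mul, Matrix.mul_smul,
          Matrix.mul_assoc, smul_smul]
        push_cast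
        module
      have e2 : (σ * (H * G)).trace = 0 := by
        rw [Matrix.trace_mul_comm, Matrix.mul_assoc, hGσ, Matrix.mul_one, htr]
      rw [e, hσG, Matrix.mul_one, Matrix.mul_one]
      simp only [Matrix.trace_add, Matrix.trace_smul, e2, htr, smul_zero, add_zero, smul_eq_mul,
        Complex.add_re, Complex.re_ofReal_mul, hc, Complex.zero_re, mul_zero]
    have hlin : (τ * matLog σ).trace.re = -vnEntropy σ + s * a := by
      rw [hτd, Matrix.add_mul, Matrix.trace_add, Complex.add_re, trace_mul_matLog hσ,
        Matrix.smul_mul, Matrix.trace_smul, smul_eq_mul, Complex.re_ofReal_mul]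
    rw [hquad, hlin, hsum] at hR
    have h8 : s * (-a) ≤ s * (s * c) := by
      have : s * (s * c) = s ^ 2 * c := by ring
      rw [this]
      linarith
    exact le_of_mul_le_mul_left h8 hs
  by_contra hneg
  push Not at hneg
  have h0 : 0 < -a := by linarith
  have hc0 : 0 < |c| + 1 := by positivity
  set s := min (ε / 2) (-a / (2 * (|c| + 1))) with hs
  have hs0 : 0 < s := lt_min (by linarith) (by positivity)
  have hsε : s < ε := lt_of_le_of_lt (min_le_left _ _) (by linarith)
  have h9 := main s hs0 hsε
  have h10 : s * (|c| + 1) ≤ -a / 2 := by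
    have : s ≤ -a / (2 * (|c| + 1)) := min_le_right _ _
    rw [le_div_iff₀ (by positivity)] at this
    linarith
  have h11 : s * c ≤ s * (|c| + 1) :=
    mul_le_mul_of_nonneg_left (by have := le_abs_self c; linarith) hs0.le
  linarith

end Final

end QMC

/-- For an ordering `(X,Y,Z)` of the three factors (arbitrary factor types,
so every ordering is covered) and a quantum-Markov-chain estimator `σ` (with `I_σ(X:Z|Y)=0`)
sharing with `ρ` the marginals on `XY` and `YZ`,
`S(ρ‖σ) = −[I_ρ(X:Y) + I_ρ(Y:Z)] + S(ρ_X) + S(ρ_Y) + S(ρ_Z) − S(ρ)`; consequently the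
estimator minimizing the relative entropy to `ρ` is the one maximizing
`I_ρ(X:Y) + I_ρ(Y:Z)`. -/
theorem relEntropy_to_qmc_estimator {X Y Z : Type*} [Fintype X] [Fintype Y] [Fintype Z]
    [DecidableEq X] [DecidableEq Y] [DecidableEq Z]
    (ρ σ : Matrix (X × Y × Z) (X × Y × Z) ℂ)
    (hρ : IsDensity ρ) (hρinv : IsUnit ρ) (hσ : IsDensity σ) (hσinv : IsUnit σ)
    (hmXY : ptC σ = ptC ρ) (hmYZ : ptA σ = ptA ρ)
    (hqmc : qcmi σ = 0) :
    relEntropy ρ σ = -(qmiXY ρ + qmiYZ ρ)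
      + (vnEntropy (ptBC ρ) + vnEntropy (ptAC ρ) + vnEntropy (ptAB ρ)) - vnEntropy ρ := by
  have hρp : ρ.PosDef := (Matrix.PosSemidef.posDef_iff_isUnit hρ.1).mpr hρinv
  have hσp : σ.PosDef := (Matrix.PosSemidef.posDef_iff_isUnit hσ.1).mpr hσinv
  have hne : Nonempty (X × Y × Z) := by
    by_contra hcon
    rw [not_nonempty_iff] at hcon
    have := hρ.2
    simp [Matrix.trace] at this
  obtain ⟨x, y, z⟩ := hne
  haveI : Nonempty X := ⟨x⟩
  haveI : Nonempty Y := ⟨y⟩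
  haveI : Nonempty Z := ⟨z⟩
  have hC : ∀ u v, ptC u = ptC v → ptC (u - v : Matrix (X × Y × Z) (X × Y × Z) ℂ) = 0 := by
    intro u v huv
    ext a b
    have := congrFun (congrFun huv a) b
    simp only [ptC] at this
    simp [ptC, Finset.sum_sub_distrib, this]
  have hA : ∀ u v, ptA u = ptA v → ptA (u - v : Matrix (X × Y × Z) (X × Y × Z) ℂ) = 0 := by
    intro u v huv
    ext a b
    have := congrFun (congrFun huv a) b
    simp only [ptA] at this
    simp [ptA, Finset.sum_sub_distrib, this]
  have h1 := QMC.trace_log_nonneg hσp (hρp.isHermitian.sub hσp.isHermitian)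
    (hC _ _ hmXY.symm) (hA _ _ hmYZ.symm) hqmc
  have h2 := QMC.trace_log_nonneg hσp (hσp.isHermitian.sub hρp.isHermitian)
    (hC _ _ hmXY) (hA _ _ hmYZ) hqmc
  rw [Matrix.sub_mul, Matrix.trace_sub, Complex.sub_re, QMC.trace_mul_matLog hσp] at h1 h2
  rw [relEntropy, Matrix.mul_sub, Matrix.trace_sub, Complex.sub_re, QMC.trace_mul_matLog hρp,
    qmiXY, qmiYZ]
  rw [qcmi, QMC.ptAC_eq, hmXY, hmYZ, ← QMC.ptAC_eq] at hqmc
  linarith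
end

section
/- Let T be a tree on vertex set {1,...,n} with edge set E, let H_1,...,H_n be finite-dimensional complex Hilbert spaces, and let σ be an invertible density operator on H_1⊗···⊗H_n satisfying the global Markov property with respect to T (for all disjoint vertex sets U, W separated by a set S in T, I_σ(U:W|S) = 0). Then log σ = Σ_{{i,j}∈E} log σ_{ij} − Σ_{i=1}^n (deg(i) − 1) log σ_i, where σ_{ij} and σ_i denote the bipartite and single-site marginals of σ, extended to the full space by tensoring with identities, and deg(i) is the degree of vertex i in T. -/
open scoped Matrix ComplexOrder

section Multipartite

variable {n : ℕ} {d : Fin n → ℕ}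

/-- The marginal of a multipartite state on the sites in `S`, obtained by tracing out the
complementary sites. -/
noncomputable def marg (S : Finset (Fin n))
    (ρ : Matrix (∀ i, Fin (d i)) (∀ i, Fin (d i)) ℂ) :
    Matrix (∀ i : {j // j ∈ S}, Fin (d i.1)) (∀ i : {j // j ∈ S}, Fin (d i.1)) ℂ :=
  fun x y => ∑ z : ∀ i : {j // j ∉ S}, Fin (d i.1),
    ρ (fun i => if h : i ∈ S then x ⟨i, h⟩ else z ⟨i, h⟩)
      (fun i => if h : i ∈ S then y ⟨i, h⟩ else z ⟨i, h⟩)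

/-- Extend an operator acting on the sites in `S` to the full multipartite space by tensoring
with the identity on the complementary sites. -/
noncomputable def extSub (S : Finset (Fin n))
    (M : Matrix (∀ i : {j // j ∈ S}, Fin (d i.1)) (∀ i : {j // j ∈ S}, Fin (d i.1)) ℂ) :
    Matrix (∀ i, Fin (d i)) (∀ i, Fin (d i)) ℂ :=
  fun x y =>
    M (fun i => x i.1) (fun i => y i.1) *
      (if (fun i : {j // j ∉ S} => x i.1) = (fun i : {j // j ∉ S} => y i.1) then 1 else 0)

/-- The quantum conditional mutual information `I_ρ(U:W|S)` between the groups of sites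
`U` and `W` given the group `S`. -/
noncomputable def qcmiSets (U W S : Finset (Fin n))
    (ρ : Matrix (∀ i, Fin (d i)) (∀ i, Fin (d i)) ℂ) : ℝ :=
  vnEntropy (marg (U ∪ S) ρ) + vnEntropy (marg (W ∪ S) ρ)
    - vnEntropy (marg S ρ) - vnEntropy (marg (U ∪ W ∪ S) ρ)

/-- `S` separates `U` and `W` in the graph `G`: every walk from a vertex of `U` to a vertex of
`W` meets `S`. -/
def SeparatesIn (G : SimpleGraph (Fin n)) (U W S : Finset (Fin n)) : Prop :=
  ∀ u ∈ U, ∀ w ∈ W, ∀ p : G.Walk u w, ∃ s ∈ S, s ∈ p.support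

/-- The global Markov property of a multipartite state with respect to a graph `G`: whenever
disjoint groups of sites `U` and `W` are separated by `S` in `G`, `I_ρ(U:W|S) = 0`. -/
def GlobalMarkov (G : SimpleGraph (Fin n))
    (ρ : Matrix (∀ i, Fin (d i)) (∀ i, Fin (d i)) ℂ) : Prop :=
  ∀ U W S : Finset (Fin n), Disjoint U W → Disjoint U S → Disjoint W S →
    SeparatesIn G U W S → qcmiSets U W S ρ = 0

/-- The edges of a graph on `Fin n`, as ordered pairs `(i, j)` with `i < j`. -/
noncomputable def edgePairs (G : SimpleGraph (Fin n)) [DecidableRel G.Adj] :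
    Finset (Fin n × Fin n) :=
  Finset.univ.filter (fun p : Fin n × Fin n => p.1 < p.2 ∧ G.Adj p.1 p.2)

end Multipartite

section Abstract
variable {n : Type*} [Fintype n] [DecidableEq n]

lemma matFun_of_unitary (f : ℝ → ℝ) (U A : Matrix n n ℂ) (a : n → ℝ)
    (hU : U * Uᴴ = 1) (hU' : Uᴴ * U = 1)
    (hA : A = U * Matrix.diagonal (fun i => (a i : ℂ)) * Uᴴ) :
    matFun f A = U * Matrix.diagonal (fun i => (f (a i) : ℂ)) * Uᴴ := by
  have hH : A.IsHermitian := by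
    rw [hA, Matrix.IsHermitian]
    simp only [Matrix.conjTranspose_mul, Matrix.conjTranspose_conjTranspose,
      Matrix.diagonal_conjTranspose, Matrix.mul_assoc]
    congr 3
    ext i
    simp
  rw [matFun, dif_pos hH]
  set V : Matrix n n ℂ := (hH.eigenvectorUnitary : Matrix n n ℂ) with hV
  have hV1 : V * Vᴴ = 1 := by
    have := Unitary.mul_star_self_of_mem hH.eigenvectorUnitary.2
    simpa [Matrix.star_eq_conjTranspose] using this
  have hV2 : Vᴴ * V = 1 := by
    have := Unitary.star_mul_self_of_mem hH.eigenvectorUnitary.2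
    simpa [Matrix.star_eq_conjTranspose] using this
  have hsp : A = V * Matrix.diagonal (fun i => (hH.eigenvalues i : ℂ)) * Vᴴ := by
    have := hH.spectral_theorem
    simpa [Unitary.conjStarAlgAut_apply, Matrix.star_eq_conjTranspose, Function.comp_def] using this
  rw [Matrix.star_eq_conjTranspose]
  have key : Uᴴ * V * Matrix.diagonal (fun i => (hH.eigenvalues i : ℂ)) =
      Matrix.diagonal (fun i => (a i : ℂ)) * (Uᴴ * V) := by
    calc Uᴴ * V * Matrix.diagonal (fun i => (hH.eigenvalues i : ℂ))
        = Uᴴ * (V * Matrix.diagonal (fun i => (hH.eigenvalues i : ℂ)) * Vᴴ) * V := by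
          simp only [Matrix.mul_assoc, hV2, Matrix.mul_one]
      _ = Uᴴ * (U * Matrix.diagonal (fun i => (a i : ℂ)) * Uᴴ) * V := by rw [← hsp, ← hA]
      _ = (Uᴴ * U) * Matrix.diagonal (fun i => (a i : ℂ)) * (Uᴴ * V) := by
          simp only [Matrix.mul_assoc]
      _ = _ := by rw [hU', Matrix.one_mul]
  have key2 : Uᴴ * V * Matrix.diagonal (fun i => (f (hH.eigenvalues i) : ℂ)) =
      Matrix.diagonal (fun i => (f (a i) : ℂ)) * (Uᴴ * V) := by
    ext i j
    have := congrFun (congrFun key i) j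
    rw [Matrix.mul_diagonal, Matrix.diagonal_mul] at this ⊢
    by_cases h0 : (Uᴴ * V) i j = 0
    · simp [h0]
    · rw [mul_comm] at this
      have h1 := mul_right_cancel₀ h0 this
      have h2 : hH.eigenvalues i = hH.eigenvalues i := rfl
      have h3 : hH.eigenvalues j = a i := by exact_mod_cast h1
      rw [h3, mul_comm]
  calc V * Matrix.diagonal (fun i => (f (hH.eigenvalues i) : ℂ)) * Vᴴ
      = (U * Uᴴ) * V * Matrix.diagonal (fun i => (f (hH.eigenvalues i) : ℂ)) * Vᴴ := by
        rw [hU, Matrix.one_mul]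
    _ = U * (Uᴴ * V * Matrix.diagonal (fun i => (f (hH.eigenvalues i) : ℂ))) * Vᴴ := by
        simp only [Matrix.mul_assoc]
    _ = U * Matrix.diagonal (fun i => (f (a i) : ℂ)) * Uᴴ * (V * Vᴴ) := by
        rw [key2]; simp only [Matrix.mul_assoc]
    _ = _ := by rw [hV1, Matrix.mul_one]

lemma posDef_spectral (A : Matrix n n ℂ) (hA : A.PosDef) :
    ∃ (U : Matrix n n ℂ) (a : n → ℝ), U * Uᴴ = 1 ∧ Uᴴ * U = 1 ∧ (∀ i, 0 < a i) ∧
      A = U * Matrix.diagonal (fun i => (a i : ℂ)) * Uᴴ ∧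
      matLog A = U * Matrix.diagonal (fun i => (Real.log (a i) : ℂ)) * Uᴴ ∧
      vnEntropy A = - ∑ i, a i * Real.log (a i) := by
  have hH := hA.isHermitian
  refine ⟨(hH.eigenvectorUnitary : Matrix n n ℂ), hH.eigenvalues, ?_, ?_, hA.eigenvalues_pos,
    ?_, ?_, ?_⟩
  · simpa [Matrix.star_eq_conjTranspose] using
      Unitary.mul_star_self_of_mem hH.eigenvectorUnitary.2
  · simpa [Matrix.star_eq_conjTranspose] using
      Unitary.star_mul_self_of_mem hH.eigenvectorUnitary.2
  · have := hH.spectral_theorem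
    simpa [Unitary.conjStarAlgAut_apply, Matrix.star_eq_conjTranspose, Function.comp_def] using this
  · rw [matLog, matFun, dif_pos hH]; rfl
  · rw [vnEntropy, dif_pos hH]

lemma trace_mul_matLog (A : Matrix n n ℂ) (hA : A.PosDef) :
    ((A * matLog A).trace).re = - vnEntropy A := by
  obtain ⟨U, a, h1, h2, h3, h4, h5, h6⟩ := posDef_spectral A hA
  rw [h6, neg_neg, h5]
  conv_lhs => rw [h4]
  have : U * Matrix.diagonal (fun i => (a i : ℂ)) * Uᴴ *
      (U * Matrix.diagonal (fun i => (Real.log (a i) : ℂ)) * Uᴴ) =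
      U * (Matrix.diagonal (fun i => (a i : ℂ)) * (Uᴴ * U) *
        Matrix.diagonal (fun i => (Real.log (a i) : ℂ))) * Uᴴ := by
    simp only [Matrix.mul_assoc]
  rw [this, h2, Matrix.mul_one, Matrix.trace_mul_comm, ← Matrix.mul_assoc, h2, Matrix.one_mul,
    Matrix.diagonal_mul_diagonal, Matrix.trace_diagonal]
  simp [← Complex.ofReal_mul]

lemma posDef_proj (A : Matrix n n ℂ) (hA : A.PosDef) :
    ∃ (a : n → ℝ) (Q : n → Matrix n n ℂ), (∀ i, 0 < a i) ∧ ∑ i, Q i = 1 ∧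
      matLog A = ∑ i, (Real.log (a i) : ℂ) • Q i ∧ (∀ i, A * Q i = (a i : ℂ) • Q i) ∧
      (∀ i, Q i * A = (a i : ℂ) • Q i) := by
  obtain ⟨U, a, h1, h2, h3, h4, h5, h6⟩ := posDef_spectral A hA
  have hdiag : ∀ b : n → ℂ, U * Matrix.diagonal b * Uᴴ =
      ∑ i, b i • (U * Matrix.single i i 1 * Uᴴ) := by
    intro b
    have : Matrix.diagonal b = ∑ i, b i • Matrix.single i i (1 : ℂ) := by
      ext x y
      simp [Matrix.sum_apply, Matrix.single_apply, Matrix.diagonal_apply]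
      by_cases hxy : x = y
      · subst hxy; simp
      · simp [hxy]
        symm
        apply Finset.sum_eq_zero
        intro i _
        by_cases h : i = x
        · subst h; simp [hxy]
        · simp [h]
    rw [this, Matrix.mul_sum, Matrix.sum_mul]
    simp only [Matrix.mul_smul, Matrix.smul_mul]
  have hAQ : ∀ i, Matrix.diagonal (fun i => (a i : ℂ)) * Matrix.single i i (1 : ℂ) =
      (a i : ℂ) • Matrix.single i i (1 : ℂ) := by
    intro i
    ext x y
    simp [Matrix.diagonal_mul, Matrix.single_apply]
    split_ifs with h
    · rw [h.1]
    · rfl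
  have hQA : ∀ i, Matrix.single i i (1 : ℂ) * Matrix.diagonal (fun i => (a i : ℂ)) =
      (a i : ℂ) • Matrix.single i i (1 : ℂ) := by
    intro i
    ext x y
    simp [Matrix.mul_diagonal, Matrix.single_apply]
    split_ifs with h
    · rw [h.2]
    · rfl
  refine ⟨a, fun i => U * Matrix.single i i 1 * Uᴴ, h3, ?_, ?_, ?_, ?_⟩
  · have := hdiag (fun _ => 1)
    simp only [one_smul] at this
    rw [← this, Matrix.diagonal_one, Matrix.mul_one, h1]
  · rw [h5, hdiag]
  · intro i
    conv_lhs => rw [h4]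
    calc _ = U * (Matrix.diagonal (fun i => (a i : ℂ)) * (Uᴴ * U) * Matrix.single i i 1) * Uᴴ := by
          simp only [Matrix.mul_assoc]
      _ = _ := by rw [h2, Matrix.mul_one, hAQ, Matrix.mul_smul, Matrix.smul_mul]
  · intro i
    conv_lhs => rw [h4]
    calc _ = U * (Matrix.single i i 1 * (Uᴴ * U) * Matrix.diagonal (fun i => (a i : ℂ))) * Uᴴ := by
          simp only [Matrix.mul_assoc]
      _ = _ := by rw [h2, Matrix.mul_one, hQA, Matrix.mul_smul, Matrix.smul_mul]

lemma pair_spectral (ρ σ : Matrix n n ℂ) (hρ : ρ.PosDef) (hσ : σ.PosDef) :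
    ∃ (c : n × n → ℝ) (E : n × n → Matrix n n ℂ), (∀ k, 0 < c k) ∧ ∑ k, E k = 1 ∧
      ∑ k, (Real.log (c k) : ℂ) • E k = matLog σ - matLog ρ ∧
      ∀ t : ℝ, 0 ≤ t → σ * (∑ k, (((c k + t)⁻¹ : ℝ) : ℂ) • E k) +
        (t : ℂ) • ((∑ k, (((c k + t)⁻¹ : ℝ) : ℂ) • E k) * ρ) = ρ := by
  obtain ⟨p, P, hp, hP1, hPl, hP2, hP3⟩ := posDef_proj ρ hρ
  obtain ⟨q, Q, hq, hQ1, hQl, hQ2, hQ3⟩ := posDef_proj σ hσ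
  refine ⟨fun k => q k.1 / p k.2, fun k => Q k.1 * P k.2, fun k => div_pos (hq _) (hp _), ?_, ?_, ?_⟩
  · rw [Fintype.sum_prod_type, ← Finset.sum_mul_sum, hP1, hQ1, one_mul]
  · rw [hPl, hQl, Fintype.sum_prod_type]
    have : ∀ x y, ((Real.log (q x / p y) : ℝ) : ℂ) • (Q x * P y) =
        ((Real.log (q x) : ℂ) • Q x) * P y - Q x * ((Real.log (p y) : ℂ) • P y) := by
      intro x y
      rw [Real.log_div (hq x).ne' (hp y).ne', Complex.ofReal_sub, sub_smul,
        Matrix.smul_mul, Matrix.mul_smul]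
    simp only [this, Finset.sum_sub_distrib]
    rw [← Finset.sum_mul_sum, ← Finset.sum_mul_sum, hP1, hQ1, one_mul, mul_one]
  · intro t ht
    have hρ' : ρ = ∑ k : n × n, Q k.1 * ((p k.2 : ℂ) • P k.2) := by
      rw [Fintype.sum_prod_type]
      simp only []
      rw [← Finset.sum_mul_sum, hQ1, one_mul]
      simp only [← hP2]
      rw [← Finset.mul_sum, hP1, mul_one]
    conv_rhs => rw [hρ']
    rw [Finset.mul_sum, Finset.sum_mul, Finset.smul_sum, ← Finset.sum_add_distrib]
    refine Finset.sum_congr rfl fun k _ => ?_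
    have hc : q k.1 / p k.2 + t ≠ 0 := by
      have := div_pos (hq k.1) (hp k.2); positivity
    have hc' : q k.1 + p k.2 * t ≠ 0 := by
      have := hq k.1; have := hp k.2; positivity
    have hpk := (hp k.2).ne'
    rw [Matrix.mul_smul, Matrix.smul_mul, ← Matrix.mul_assoc, hQ2, Matrix.mul_assoc, hP3,
      Matrix.smul_mul, Matrix.mul_smul, smul_smul, smul_smul, smul_smul, ← add_smul]
    congr 1
    rw [← Complex.ofReal_mul, ← Complex.ofReal_mul, ← Complex.ofReal_mul, ← Complex.ofReal_add]
    congr 1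
    field_simp

lemma form_nonneg (ρ σ : Matrix n n ℂ) (hρ : ρ.PosDef) (hσ : σ.PosDef) (t : ℝ) (ht : 0 ≤ t)
    (u : Matrix n n ℂ) :
    0 ≤ ((uᴴ * (σ * u + (t : ℂ) • (u * ρ))).trace).re ∧
    (((uᴴ * (σ * u + (t : ℂ) • (u * ρ))).trace).re = 0 → u = 0) := by
  have h1 : (uᴴ * σ * u).PosSemidef := hσ.posSemidef.conjTranspose_mul_mul_same u
  have h2 : (u * ρ * uᴴ).PosSemidef := hρ.posSemidef.mul_mul_conjTranspose_same u
  have e : ((uᴴ * (σ * u + (t : ℂ) • (u * ρ))).trace).re =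
      ((uᴴ * σ * u).trace).re + t * ((u * ρ * uᴴ).trace).re := by
    rw [Matrix.mul_add, Matrix.trace_add, Matrix.mul_smul, Matrix.trace_smul,
      Matrix.trace_mul_comm uᴴ (u * ρ), Matrix.mul_assoc uᴴ]
    simp
  have n1 := (Complex.le_def.1 h1.trace_nonneg).1
  have n2 := (Complex.le_def.1 h2.trace_nonneg).1
  simp only [Complex.zero_re] at n1 n2
  rw [e]
  refine ⟨by positivity, fun h => ?_⟩
  have h0 : ((uᴴ * σ * u).trace).re = 0 := by nlinarith [mul_nonneg ht n2]
  have h00 : (uᴴ * σ * u).trace = 0 := by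
    apply Complex.ext h0
    exact (Complex.le_def.1 h1.trace_nonneg).2.symm
  have h3 : uᴴ * σ * u = 0 := h1.trace_eq_zero_iff.1 h00
  ext i j
  by_contra hne
  have hv : (fun i => u i j) ≠ 0 := fun h => hne (congrFun h i)
  have h4 := hσ.dotProduct_mulVec_pos hv
  have h5 := congrFun (congrFun h3 j) j
  rw [Matrix.mul_assoc, Matrix.mul_apply] at h5
  have : star (fun i => u i j) ⬝ᵥ σ *ᵥ (fun i => u i j) = 0 := h5
  rw [this] at h4
  exact lt_irrefl _ h4

end Abstract

section Scalar
open Filter Topology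
variable {K : Type*} [Fintype K]

lemma scalar_hasDeriv (w c : K → ℝ) (hc : ∀ k, 0 < c k) (t : ℝ) (ht : 0 ≤ t) :
    HasDerivAt (fun t => ∑ k, w k * Real.log (c k + t)) (∑ k, w k * (c k + t)⁻¹) t := by
  apply HasDerivAt.fun_sum
  intro k _
  have h : c k + t ≠ 0 := by have := hc k; positivity
  have := ((hasDerivAt_id t).const_add (c k)).log h
  simpa using this.const_mul (w k)

lemma scalar_tendsto (w c : K → ℝ) (hc : ∀ k, 0 < c k) (hw : ∑ k, w k = 0) :
    Tendsto (fun t => ∑ k, w k * Real.log (c k + t)) atTop (𝓝 0) := by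
  have h1 : Tendsto (fun t : ℝ => ∑ k, w k * Real.log (c k / t + 1)) atTop (𝓝 0) := by
    have : (0 : ℝ) = ∑ k, w k * Real.log (0 + 1) := by simp
    rw [this]
    apply tendsto_finsetSum
    intro k _
    apply Tendsto.const_mul
    apply Tendsto.log _ (by norm_num)
    apply Tendsto.add_const
    exact tendsto_const_nhds.div_atTop tendsto_id
  refine h1.congr' ?_
  filter_upwards [eventually_gt_atTop 0] with t ht
  have : ∀ k, w k * Real.log (c k + t) = w k * Real.log (c k / t + 1) + w k * Real.log t := by
    intro k
    have h2 : c k / t + 1 ≠ 0 := by have := hc k; positivity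
    rw [← mul_add, ← Real.log_mul h2 ht.ne']
    congr 2
    field_simp
  simp only [this, Finset.sum_add_distrib, ← Finset.sum_mul, hw, zero_mul, add_zero]

lemma scalar_zero (w c : K → ℝ) (hc : ∀ k, 0 < c k) (hw : ∑ k, w k = 0)
    (h : ∀ t : ℝ, 0 < t → ∑ k, w k * (c k + t)⁻¹ = 0) :
    ∑ k, w k * Real.log (c k) = 0 := by
  set F : ℝ → ℝ := fun t => ∑ k, w k * Real.log (c k + t) with hF
  have hcont : ContinuousOn F (Set.Ici 0) := fun t ht =>
    (scalar_hasDeriv w c hc t ht).continuousAt.continuousWithinAt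
  have hmono : MonotoneOn F (Set.Ici 0) := by
    apply monotoneOn_of_deriv_nonneg (convex_Ici 0) hcont
    · intro t ht
      rw [interior_Ici] at ht
      exact (scalar_hasDeriv w c hc t (le_of_lt ht)).differentiableAt.differentiableWithinAt
    · intro t ht
      rw [interior_Ici] at ht
      rw [(scalar_hasDeriv w c hc t (le_of_lt ht)).deriv, h t ht]
  have hanti : AntitoneOn F (Set.Ici 0) := by
    apply antitoneOn_of_deriv_nonpos (convex_Ici 0) hcont
    · intro t ht
      rw [interior_Ici] at ht
      exact (scalar_hasDeriv w c hc t (le_of_lt ht)).differentiableAt.differentiableWithinAt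
    · intro t ht
      rw [interior_Ici] at ht
      rw [(scalar_hasDeriv w c hc t (le_of_lt ht)).deriv, h t ht]
  have hconst : ∀ᶠ t in atTop, F t = F 0 := by
    filter_upwards [eventually_ge_atTop 0] with t ht
    exact le_antisymm (hanti (Set.mem_Ici.2 le_rfl) ht ht) (hmono (Set.mem_Ici.2 le_rfl) ht ht)
  have h1 : Tendsto F atTop (𝓝 (F 0)) := (tendsto_const_nhds).congr' (hconst.mono fun t h => h.symm)
  have h2 := tendsto_nhds_unique h1 (scalar_tendsto w c hc hw)
  simpa [hF] using h2

lemma scalar_deriv_zero (w c : K → ℝ) (hc : ∀ k, 0 < c k) (hw : ∑ k, w k = 0)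
    (h : ∀ t : ℝ, 0 < t → 0 ≤ ∑ k, w k * (c k + t)⁻¹)
    (h0 : ∑ k, w k * Real.log (c k) = 0) :
    ∀ t : ℝ, 0 < t → ∑ k, w k * (c k + t)⁻¹ = 0 := by
  set F : ℝ → ℝ := fun t => ∑ k, w k * Real.log (c k + t) with hF
  have hcont : ContinuousOn F (Set.Ici 0) := fun t ht =>
    (scalar_hasDeriv w c hc t ht).continuousAt.continuousWithinAt
  have hmono : MonotoneOn F (Set.Ici 0) := by
    apply monotoneOn_of_deriv_nonneg (convex_Ici 0) hcont
    · intro t ht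
      rw [interior_Ici] at ht
      exact (scalar_hasDeriv w c hc t (le_of_lt ht)).differentiableAt.differentiableWithinAt
    · intro t ht
      rw [interior_Ici] at ht
      rw [(scalar_hasDeriv w c hc t (le_of_lt ht)).deriv]
      exact h t ht
  have hF0 : F 0 = 0 := by simpa [hF] using h0
  have hzero : ∀ t, 0 < t → F t = 0 := by
    intro t ht
    apply le_antisymm
    · apply ge_of_tendsto (scalar_tendsto w c hc hw)
      filter_upwards [eventually_ge_atTop t] with s hs
      exact hmono (Set.mem_Ici.2 ht.le) (Set.mem_Ici.2 (ht.le.trans hs)) hs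
    · rw [← hF0]
      exact hmono (Set.mem_Ici.2 le_rfl) (Set.mem_Ici.2 ht.le) ht.le
  intro t ht
  have hd := scalar_hasDeriv w c hc t ht.le
  have hd2 : HasDerivAt F 0 t := by
    apply (hasDerivAt_const t (0 : ℝ)).congr_of_eventuallyEq
    filter_upwards [eventually_gt_nhds ht] with s hs
    exact hzero s hs
  exact hd.unique hd2

end Scalar

section Abstract2
variable {n : Type*} [Fintype n] [DecidableEq n]

lemma solution_mem (ρ σ : Matrix n n ℂ) (hρ : ρ.PosDef) (hσ : σ.PosDef)
    (𝒜 : Subalgebra ℂ (Matrix n n ℂ)) (hρA : ρ ∈ 𝒜) (hσA : σ ∈ 𝒜) (t : ℝ) (ht : 0 ≤ t)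
    (X : Matrix n n ℂ) (hX : σ * X + (t : ℂ) • (X * ρ) = ρ) : X ∈ 𝒜 := by
  let f : 𝒜 →ₗ[ℂ] 𝒜 := LinearMap.mulLeft ℂ (⟨σ, hσA⟩ : 𝒜) +
    (t : ℂ) • LinearMap.mulRight ℂ (⟨ρ, hρA⟩ : 𝒜)
  have hf : ∀ Y : 𝒜, ((f Y : 𝒜) : Matrix n n ℂ) = σ * Y + (t : ℂ) • ((Y : Matrix n n ℂ) * ρ) := by
    intro Y; simp [f]
  have hinj0 : ∀ Y : Matrix n n ℂ, σ * Y + (t : ℂ) • (Y * ρ) = 0 → Y = 0 := by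
    intro Y hY
    apply (form_nonneg ρ σ hρ hσ t ht Y).2
    rw [hY]; simp
  have hinj : Function.Injective f := by
    rw [injective_iff_map_eq_zero]
    intro Y hY
    have := hf Y
    rw [hY] at this
    exact Subtype.ext (hinj0 Y this.symm)
  obtain ⟨Y, hY⟩ := LinearMap.injective_iff_surjective.1 hinj ⟨ρ, hρA⟩
  have h1 := hf Y
  rw [hY] at h1
  have h2 : X - (Y : Matrix n n ℂ) = 0 := by
    apply hinj0
    rw [Matrix.mul_sub, Matrix.sub_mul, smul_sub]
    have h3 : σ * X + (t : ℂ) • (X * ρ) = σ * Y + (t : ℂ) • ((Y : Matrix n n ℂ) * ρ) := by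
      rw [hX]; exact h1
    rw [sub_add_sub_comm, h3, sub_self]
  rw [sub_eq_zero.1 h2]
  exact Y.2

lemma gap_eq (ρ σ ρ0 σ0 X Y : Matrix n n ℂ) (hρ : ρ.PosDef) (hσ : σ.PosDef)
    (κ : ℂ) (t : ℝ)
    (𝒜 : Subalgebra ℂ (Matrix n n ℂ)) (hstar : ∀ Z ∈ 𝒜, Zᴴ ∈ 𝒜)
    (h1 : ∀ Z ∈ 𝒜, (ρ * Z).trace = κ * (ρ0 * Z).trace)
    (h2 : ∀ Z ∈ 𝒜, (σ * Z).trace = κ * (σ0 * Z).trace)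
    (hX : σ * X + (t : ℂ) • (X * ρ) = ρ) (hY : σ0 * Y + (t : ℂ) • (Y * ρ0) = ρ0) (hYA : Y ∈ 𝒜) :
    (((X - Y)ᴴ * (σ * (X - Y) + (t : ℂ) • ((X - Y) * ρ))).trace).re = ((ρ * (X - Y)).trace).re := by
  have hYs := hstar Y hYA
  have e1 : σ * (X - Y) + (t : ℂ) • ((X - Y) * ρ) = ρ - (σ * Y + (t : ℂ) • (Y * ρ)) := by
    conv_rhs => lhs; rw [← hX]
    rw [Matrix.mul_sub, Matrix.sub_mul, smul_sub]; abel
  have hXs : Xᴴ * σ + (t : ℂ) • (ρ * Xᴴ) = ρ := by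
    have := congrArg Matrix.conjTranspose hX
    simpa [Matrix.conjTranspose_add, Matrix.conjTranspose_mul, Matrix.conjTranspose_smul,
      hρ.isHermitian.eq, hσ.isHermitian.eq] using this
  have e2 : (Xᴴ * (σ * Y + (t : ℂ) • (Y * ρ))).trace = (ρ * Y).trace := by
    conv_rhs => rw [← hXs]
    rw [Matrix.mul_add, Matrix.add_mul, Matrix.trace_add, Matrix.trace_add, Matrix.mul_smul,
      Matrix.smul_mul, Matrix.trace_smul, Matrix.trace_smul, Matrix.mul_assoc Xᴴ,
      Matrix.mul_assoc ρ, Matrix.trace_mul_comm ρ, Matrix.mul_assoc Xᴴ]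
  have e3 : (Yᴴ * (σ * Y + (t : ℂ) • (Y * ρ))).trace = (Yᴴ * ρ).trace := by
    have a1 : (Yᴴ * (σ * Y)).trace = κ * (Yᴴ * (σ0 * Y)).trace := by
      rw [Matrix.trace_mul_comm Yᴴ, Matrix.trace_mul_comm Yᴴ, Matrix.mul_assoc, Matrix.mul_assoc]
      exact h2 _ (𝒜.mul_mem hYA hYs)
    have a2 : (Yᴴ * (Y * ρ)).trace = κ * (Yᴴ * (Y * ρ0)).trace := by
      rw [← Matrix.mul_assoc, ← Matrix.mul_assoc, Matrix.trace_mul_comm _ ρ,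
        Matrix.trace_mul_comm _ ρ0]
      exact h1 _ (𝒜.mul_mem hYs hYA)
    have a3 : (Yᴴ * ρ).trace = κ * (Yᴴ * ρ0).trace := by
      rw [Matrix.trace_mul_comm _ ρ, Matrix.trace_mul_comm _ ρ0]
      exact h1 _ hYs
    rw [a3]
    conv_rhs => rw [← hY]
    rw [Matrix.mul_add, Matrix.mul_add, Matrix.trace_add, Matrix.trace_add, Matrix.mul_smul,
      Matrix.mul_smul, Matrix.trace_smul, Matrix.trace_smul, a1, a2]
    simp only [smul_eq_mul]; ring
  have e4 : ((Xᴴ * ρ).trace).re = ((ρ * X).trace).re := by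
    have : Xᴴ * ρ = (ρ * X)ᴴ := by rw [Matrix.conjTranspose_mul, hρ.isHermitian.eq]
    rw [this, Matrix.trace_conjTranspose]; simp
  rw [e1, Matrix.conjTranspose_sub, Matrix.sub_mul, Matrix.mul_sub, Matrix.mul_sub]
  simp only [Matrix.trace_sub, e2, e3, Matrix.mul_sub, Complex.sub_re, e4]
  ring

theorem abstract_equality (ρ σ ρ0 σ0 : Matrix n n ℂ) (hρ : ρ.PosDef) (hσ : σ.PosDef)
    (hρ0 : ρ0.PosDef) (hσ0 : σ0.PosDef) (κ : ℂ)
    (𝒜 : Subalgebra ℂ (Matrix n n ℂ)) (hstar : ∀ Z ∈ 𝒜, Zᴴ ∈ 𝒜) (hρA : ρ0 ∈ 𝒜) (hσA : σ0 ∈ 𝒜)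
    (h1 : ∀ Z ∈ 𝒜, (ρ * Z).trace = κ * (ρ0 * Z).trace)
    (h2 : ∀ Z ∈ 𝒜, (σ * Z).trace = κ * (σ0 * Z).trace)
    (heq : ((ρ * ((matLog σ - matLog ρ) - (matLog σ0 - matLog ρ0))).trace).re = 0) :
    matLog σ - matLog ρ = matLog σ0 - matLog ρ0 := by
  obtain ⟨c, E, hc, hE1, hEl, hEX⟩ := pair_spectral ρ σ hρ hσ
  obtain ⟨c', E', hc', hE1', hEl', hEX'⟩ := pair_spectral ρ0 σ0 hρ0 hσ0
  let C : (n × n) ⊕ (n × n) → ℝ := Sum.elim c c'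
  have hC : ∀ k, 0 < C k := by rintro (k | k); exacts [hc k, hc' k]
  let w : Matrix n n ℂ → (n × n) ⊕ (n × n) → ℝ := fun Z =>
    Sum.elim (fun k => ((Z * E k).trace).re) (fun k => - ((Z * E' k).trace).re)
  have hsum : ∀ (Z : Matrix n n ℂ) (f : ℝ → ℝ), ∑ k, w Z k * f (C k) =
      ((Z * (∑ k, (f (c k) : ℂ) • E k - ∑ k, (f (c' k) : ℂ) • E' k)).trace).re := by
    intro Z f
    rw [Fintype.sum_sum_type, Matrix.mul_sub, Matrix.trace_sub, Complex.sub_re, sub_eq_add_neg]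
    simp only [w, C, Sum.elim_inl, Sum.elim_inr, Finset.mul_sum, Matrix.trace_sum,
      Matrix.mul_smul, Matrix.trace_smul, smul_eq_mul, Complex.re_sum, Complex.re_ofReal_mul,
      neg_mul, Finset.sum_neg_distrib]
    simp only [mul_comm]
  have hw : ∀ Z, ∑ k, w Z k = 0 := by
    intro Z
    have := hsum Z (fun _ => 1)
    simpa [hE1, hE1'] using this
  have hlog : ∀ Z, ∑ k, w Z k * Real.log (C k) =
      ((Z * ((matLog σ - matLog ρ) - (matLog σ0 - matLog ρ0))).trace).re := by
    intro Z
    rw [hsum Z Real.log, hEl, hEl']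
  let X : ℝ → Matrix n n ℂ := fun t => ∑ k, (((c k + t)⁻¹ : ℝ) : ℂ) • E k
  let Y : ℝ → Matrix n n ℂ := fun t => ∑ k, (((c' k + t)⁻¹ : ℝ) : ℂ) • E' k
  have hres : ∀ Z t, ∑ k, w Z k * (C k + t)⁻¹ = ((Z * (X t - Y t)).trace).re := by
    intro Z t
    exact hsum Z (fun s => (s + t)⁻¹)
  have hgap : ∀ t : ℝ, 0 < t →
      (((X t - Y t)ᴴ * (σ * (X t - Y t) + (t : ℂ) • ((X t - Y t) * ρ))).trace).re =
        ((ρ * (X t - Y t)).trace).re := by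
    intro t ht
    exact gap_eq ρ σ ρ0 σ0 (X t) (Y t) hρ hσ κ t 𝒜 hstar h1 h2 (hEX t ht.le) (hEX' t ht.le)
      (solution_mem ρ0 σ0 hρ0 hσ0 𝒜 hρA hσA t ht.le _ (hEX' t ht.le))
  have hz := scalar_deriv_zero (w ρ) C hC (hw ρ) (by
    intro t ht
    rw [hres, ← hgap t ht]
    exact (form_nonneg ρ σ hρ hσ t ht.le _).1) (by rw [hlog, heq])
  have hXY : ∀ t : ℝ, 0 < t → X t - Y t = 0 := by
    intro t ht
    apply (form_nonneg ρ σ hρ hσ t ht.le _).2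
    rw [hgap t ht, ← hres, hz t ht]
  set D := (matLog σ - matLog ρ) - (matLog σ0 - matLog ρ0) with hD
  have hfin := scalar_zero (w Dᴴ) C hC (hw _) (by
    intro t ht
    rw [hres, hXY t ht]; simp)
  rw [hlog] at hfin
  have hpsd := Matrix.posSemidef_conjTranspose_mul_self D
  have : (Dᴴ * D).trace = 0 := by
    apply Complex.ext hfin
    exact (Complex.le_def.1 hpsd.trace_nonneg).2.symm
  have hD0 : D = 0 := Matrix.trace_conjTranspose_mul_self_eq_zero_iff.1 this
  exact sub_eq_zero.1 hD0

end Abstract2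

section Sites
open scoped Kronecker
variable {n : ℕ} {d : Fin n → ℕ}

/-- Splitting of a configuration into the part on `A` and the part off `A`. -/
noncomputable def splitEquiv (d : Fin n → ℕ) (A : Finset (Fin n)) : (∀ i, Fin (d i)) ≃
    (∀ i : {j // j ∈ A}, Fin (d i.1)) × (∀ i : {j // j ∉ A}, Fin (d i.1)) :=
  Equiv.piEquivPiSubtypeProd (fun j => j ∈ A) (fun i => Fin (d i))

lemma extSub_eq (A : Finset (Fin n))
    (M : Matrix (∀ i : {j // j ∈ A}, Fin (d i.1)) (∀ i : {j // j ∈ A}, Fin (d i.1)) ℂ) :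
    extSub A M = (M ⊗ₖ (1 : Matrix (∀ i : {j // j ∉ A}, Fin (d i.1)) _ ℂ)).submatrix
      (splitEquiv d A) (splitEquiv d A) := by
  ext x y
  simp only [extSub, Matrix.submatrix_apply, Matrix.kroneckerMap_apply, Matrix.one_apply]
  rfl

lemma extSub_mul (A : Finset (Fin n))
    (M N : Matrix (∀ i : {j // j ∈ A}, Fin (d i.1)) (∀ i : {j // j ∈ A}, Fin (d i.1)) ℂ) :
    extSub A (M * N) = extSub A M * extSub A N := by
  rw [extSub_eq, extSub_eq, extSub_eq, Matrix.submatrix_mul_equiv, ← Matrix.mul_kronecker_mul,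
    Matrix.one_mul]

lemma extSub_one (A : Finset (Fin n)) :
    extSub (d := d) A 1 = 1 := by
  rw [extSub_eq, Matrix.one_kronecker_one, Matrix.submatrix_one_equiv]

lemma extSub_add (A : Finset (Fin n))
    (M N : Matrix (∀ i : {j // j ∈ A}, Fin (d i.1)) (∀ i : {j // j ∈ A}, Fin (d i.1)) ℂ) :
    extSub A (M + N) = extSub A M + extSub A N := by
  ext x y; simp only [extSub, Matrix.add_apply, add_mul]

lemma extSub_smul (A : Finset (Fin n)) (c : ℂ)
    (M : Matrix (∀ i : {j // j ∈ A}, Fin (d i.1)) (∀ i : {j // j ∈ A}, Fin (d i.1)) ℂ) :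
    extSub A (c • M) = c • extSub A M := by
  ext x y; simp [extSub]

lemma extSub_star (A : Finset (Fin n))
    (M : Matrix (∀ i : {j // j ∈ A}, Fin (d i.1)) (∀ i : {j // j ∈ A}, Fin (d i.1)) ℂ) :
    extSub A Mᴴ = (extSub A M)ᴴ := by
  rw [extSub_eq, extSub_eq, Matrix.conjTranspose_submatrix, Matrix.conjTranspose_kronecker,
    Matrix.conjTranspose_one]

lemma extSub_diagonal (A : Finset (Fin n)) (b : (∀ i : {j // j ∈ A}, Fin (d i.1)) → ℂ) :
    extSub A (Matrix.diagonal b) = Matrix.diagonal (fun x => b (splitEquiv d A x).1) := by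
  rw [extSub_eq, ← Matrix.diagonal_one, Matrix.diagonal_kronecker_diagonal]
  ext x y
  simp [Matrix.diagonal_apply]

lemma extSub_posDef (A : Finset (Fin n))
    (M : Matrix (∀ i : {j // j ∈ A}, Fin (d i.1)) (∀ i : {j // j ∈ A}, Fin (d i.1)) ℂ)
    (hM : M.PosDef) : (extSub A M).PosDef := by
  rw [extSub_eq]
  exact (hM.kronecker Matrix.PosDef.one).submatrix (splitEquiv d A).injective

lemma matLog_extSub (A : Finset (Fin n))
    (M : Matrix (∀ i : {j // j ∈ A}, Fin (d i.1)) (∀ i : {j // j ∈ A}, Fin (d i.1)) ℂ)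
    (hM : M.PosDef) : matLog (extSub A M) = extSub A (matLog M) := by
  obtain ⟨U, a, h1, h2, h3, h4, h5, h6⟩ := posDef_spectral M hM
  rw [h5, extSub_mul, extSub_mul, extSub_diagonal, extSub_star]
  rw [matLog]
  apply matFun_of_unitary Real.log (extSub A U) (extSub A M) (fun x => a (splitEquiv d A x).1)
  · rw [← extSub_star, ← extSub_mul, h1, extSub_one]
  · rw [← extSub_star, ← extSub_mul, h2, extSub_one]
  · conv_lhs => rw [h4]
    rw [extSub_mul, extSub_mul, extSub_diagonal, extSub_star]

/-- Range of `extSub A` as a subalgebra. -/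
noncomputable def locAlg (d : Fin n → ℕ) (A : Finset (Fin n)) :
    Subalgebra ℂ (Matrix (∀ i, Fin (d i)) (∀ i, Fin (d i)) ℂ) where
  carrier := Set.range (extSub A)
  mul_mem' := by
    rintro _ _ ⟨M, rfl⟩ ⟨N, rfl⟩
    exact ⟨M * N, extSub_mul A M N⟩
  add_mem' := by
    rintro _ _ ⟨M, rfl⟩ ⟨N, rfl⟩
    exact ⟨M + N, extSub_add A M N⟩
  algebraMap_mem' := by
    intro c
    refine ⟨c • 1, ?_⟩
    rw [extSub_smul, extSub_one, Algebra.algebraMap_eq_smul_one]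

lemma mem_locAlg (A : Finset (Fin n)) (Z : Matrix (∀ i, Fin (d i)) (∀ i, Fin (d i)) ℂ) :
    Z ∈ locAlg d A ↔ ∃ M, extSub A M = Z := Iff.rfl

lemma marg_eq (A : Finset (Fin n)) (X : Matrix (∀ i, Fin (d i)) (∀ i, Fin (d i)) ℂ)
    (a b : ∀ i : {j // j ∈ A}, Fin (d i.1)) :
    marg A X a b = ∑ z, X ((splitEquiv d A).symm (a, z)) ((splitEquiv d A).symm (b, z)) := rfl

lemma marg_posDef (hd : ∀ i, 0 < d i) (A : Finset (Fin n))
    (X : Matrix (∀ i, Fin (d i)) (∀ i, Fin (d i)) ℂ) (hX : X.PosDef) : (marg A X).PosDef := by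
  have : marg A X = ∑ z, X.submatrix (fun a => (splitEquiv d A).symm (a, z))
      (fun a => (splitEquiv d A).symm (a, z)) := by
    ext a b
    rw [marg_eq, Matrix.sum_apply]; rfl
  rw [this]
  have hne : Nonempty (∀ i : {j // j ∉ A}, Fin (d i.1)) := ⟨fun i => ⟨0, hd _⟩⟩
  apply Matrix.posDef_sum Finset.univ_nonempty
  intro z _
  apply hX.submatrix
  intro a b hab
  simpa using hab

lemma trace_extSub_mul (A : Finset (Fin n)) (X : Matrix (∀ i, Fin (d i)) (∀ i, Fin (d i)) ℂ)
    (M : Matrix (∀ i : {j // j ∈ A}, Fin (d i.1)) (∀ i : {j // j ∈ A}, Fin (d i.1)) ℂ) :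
    (extSub A M * X).trace = (M * marg A X).trace := by
  simp only [Matrix.trace, Matrix.diag_apply, Matrix.mul_apply]
  rw [← (splitEquiv d A).symm.sum_comp, Fintype.sum_prod_type]
  refine Finset.sum_congr rfl fun a _ => ?_
  have : ∀ b, ∑ j, extSub A M ((splitEquiv d A).symm (a, b)) j * X j ((splitEquiv d A).symm (a, b)) =
      ∑ a', M a a' * X ((splitEquiv d A).symm (a', b)) ((splitEquiv d A).symm (a, b)) := by
    intro b
    rw [← (splitEquiv d A).symm.sum_comp, Fintype.sum_prod_type]
    refine Finset.sum_congr rfl fun a' _ => ?_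
    simp [extSub_eq, Matrix.one_apply]
  simp only [this, marg_eq, Finset.mul_sum]
  rw [Finset.sum_comm]

/-- Unnormalised conditional expectation onto the sites in `A`. -/
noncomputable def condE (A : Finset (Fin n)) (X : Matrix (∀ i, Fin (d i)) (∀ i, Fin (d i)) ℂ) :
    Matrix (∀ i, Fin (d i)) (∀ i, Fin (d i)) ℂ :=
  fun x y => (if ∀ i, i ∉ A → x i = y i then 1 else 0) *
    ∑ z : ∀ i, Fin (d i), X (A.piecewise x z) (A.piecewise y z)

lemma condE_eq (A : Finset (Fin n)) (X : Matrix (∀ i, Fin (d i)) (∀ i, Fin (d i)) ℂ) :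
    condE A X = ((∏ i ∈ A, d i : ℕ) : ℂ) • extSub A (marg A X) := by
  ext x y
  have hs : ∑ z : ∀ i, Fin (d i), X (A.piecewise x z) (A.piecewise y z) =
      ((∏ i ∈ A, d i : ℕ) : ℂ) * marg A X (fun i => x i.1) (fun i => y i.1) := by
    rw [← (splitEquiv d A).symm.sum_comp, Fintype.sum_prod_type]
    have hp : ∀ (x : ∀ i, Fin (d i)) a b, A.piecewise x ((splitEquiv d A).symm (a, b)) =
        (splitEquiv d A).symm ((fun i => x i.1), b) := by
      intro x a b
      funext i
      by_cases h : i ∈ A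
      · simp [splitEquiv, Equiv.piEquivPiSubtypeProd, h]
      · simp [splitEquiv, Equiv.piEquivPiSubtypeProd, h]
    simp only [hp, ← marg_eq, Finset.sum_const, nsmul_eq_mul, Finset.card_univ]
    congr 2
    rw [Fintype.card_pi]
    simp only [Fintype.card_fin]
    exact Finset.prod_coe_sort A d
  simp only [condE, hs, Matrix.smul_apply, extSub, smul_eq_mul, funext_iff, Subtype.forall]
  ring

lemma condE_extSub (A : Finset (Fin n))
    (M : Matrix (∀ i : {j // j ∈ A}, Fin (d i.1)) (∀ i : {j // j ∈ A}, Fin (d i.1)) ℂ) :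
    condE A (extSub A M) = (Fintype.card (∀ i, Fin (d i)) : ℂ) • extSub A M := by
  ext x y
  have : ∀ z, extSub A M (A.piecewise x z) (A.piecewise y z) =
      M (fun i => x i.1) (fun i => y i.1) := by
    intro z
    have h1 : ∀ x : ∀ i, Fin (d i), (fun i : {j // j ∈ A} => A.piecewise x z i.1) =
        fun i : {j // j ∈ A} => x i.1 := by
      intro x; funext i; simp [i.2]
    have h2 : ∀ x : ∀ i, Fin (d i), (fun i : {j // j ∉ A} => A.piecewise x z i.1) =
        fun i : {j // j ∉ A} => z i.1 := by
      intro x; funext i; simp [i.2]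
    simp [extSub, h1, h2]
  simp only [condE, this, Finset.sum_const, Finset.card_univ, nsmul_eq_mul]
  simp only [Matrix.smul_apply, extSub, smul_eq_mul, funext_iff, Subtype.forall]
  ring

lemma sum_swap (B : Finset (Fin n)) (h : (∀ i, Fin (d i)) → ℂ) :
    ∑ z : ∀ i, Fin (d i), ∑ w : ∀ i, Fin (d i), h (B.piecewise z w) =
      (Fintype.card (∀ i, Fin (d i)) : ℂ) * ∑ v, h v := by
  have hinv : Function.Involutive (fun p : (∀ i, Fin (d i)) × (∀ i, Fin (d i)) =>
      (B.piecewise p.1 p.2, B.piecewise p.2 p.1)) := by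
    intro p
    ext i
    · by_cases hi : i ∈ B <;> simp [hi]
    · by_cases hi : i ∈ B <;> simp [hi]
  rw [← Fintype.sum_prod_type' (f := fun z w => h (B.piecewise z w))]
  have := hinv.toPerm.sum_comp (s := Finset.univ) (f := fun p => h p.1) (by simp)
  simp only [Function.Involutive.coe_toPerm] at this
  rw [this, Fintype.sum_prod_type]
  simp [Finset.mul_sum]

lemma condE_condE (A B : Finset (Fin n)) (X : Matrix (∀ i, Fin (d i)) (∀ i, Fin (d i)) ℂ) :
    condE A (condE B X) = (Fintype.card (∀ i, Fin (d i)) : ℂ) • condE (A ∩ B) X := by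
  ext x y
  have hpw : ∀ x z w : ∀ i, Fin (d i), B.piecewise (A.piecewise x z) w =
      (A ∩ B).piecewise x (B.piecewise z w) := by
    intro x z w
    funext i
    by_cases h1 : i ∈ A <;> by_cases h2 : i ∈ B <;> simp [h1, h2]
  have hcond : ∀ z : ∀ i, Fin (d i),
      (∀ i, i ∉ B → A.piecewise x z i = A.piecewise y z i) ↔ ∀ i, i ∉ B → i ∈ A → x i = y i := by
    intro z
    refine forall_congr' fun i => imp_congr_right fun _ => ?_
    by_cases h1 : i ∈ A <;> simp [h1]
  have hc2 : (∀ i, i ∉ A ∩ B → x i = y i) ↔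
      (∀ i, i ∉ A → x i = y i) ∧ ∀ i, i ∉ B → i ∈ A → x i = y i := by
    constructor
    · intro h
      exact ⟨fun i hi => h i (by simp [hi]), fun i hi _ => h i (by simp [hi])⟩
    · rintro ⟨h1, h2⟩ i hi
      by_cases hA : i ∈ A
      · exact h2 i (fun hB => hi (Finset.mem_inter.2 ⟨hA, hB⟩)) hA
      · exact h1 i hA
  simp only [condE, hcond, hpw, ← Finset.mul_sum, Matrix.smul_apply, smul_eq_mul]
  rw [sum_swap B (fun v => X ((A ∩ B).piecewise x v) ((A ∩ B).piecewise y v))]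
  by_cases h1 : ∀ i, i ∉ A → x i = y i
  · by_cases h2 : ∀ i, i ∉ B → i ∈ A → x i = y i
    · rw [if_pos h1, if_pos h2, if_pos (hc2.2 ⟨h1, h2⟩)]; ring
    · rw [if_neg h2, if_neg (fun h => h2 (hc2.1 h).2)]; ring
  · rw [if_neg h1, if_neg (fun h => h1 (hc2.1 h).1)]; ring

lemma condE_adj (A : Finset (Fin n)) (X Y : Matrix (∀ i, Fin (d i)) (∀ i, Fin (d i)) ℂ) :
    (condE A X * Y).trace = (X * condE A Y).trace := by
  rw [condE_eq, condE_eq, Matrix.smul_mul, Matrix.mul_smul, Matrix.trace_smul, Matrix.trace_smul,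
    trace_extSub_mul, Matrix.trace_mul_comm X, trace_extSub_mul, Matrix.trace_mul_comm]

/-- trace pairing of a localized marginal against a local operator -/
lemma trace_pair (hd : ∀ i, 0 < d i) (A B : Finset (Fin n))
    (X : Matrix (∀ i, Fin (d i)) (∀ i, Fin (d i)) ℂ)
    (M : Matrix (∀ i : {j // j ∈ A}, Fin (d i.1)) (∀ i : {j // j ∈ A}, Fin (d i.1)) ℂ) :
    ((∏ i ∈ B, d i : ℕ) : ℂ) * (extSub B (marg B X) * extSub A M).trace =
      ((∏ i ∈ A ∩ B, d i : ℕ) : ℂ) * (extSub (A ∩ B) (marg (A ∩ B) X) * extSub A M).trace := by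
  have hD : (Fintype.card (∀ i, Fin (d i)) : ℂ) ≠ 0 := by
    have : Nonempty (∀ i, Fin (d i)) := ⟨fun i => ⟨0, hd i⟩⟩
    exact_mod_cast Fintype.card_ne_zero
  have e : ∀ C : Finset (Fin n), ((∏ i ∈ C, d i : ℕ) : ℂ) *
      (extSub C (marg C X) * extSub A M).trace = (condE C X * extSub A M).trace := by
    intro C
    rw [condE_eq, Matrix.smul_mul, Matrix.trace_smul, smul_eq_mul]
  rw [e, e]
  apply mul_left_cancel₀ hD
  have f : ∀ C, (Fintype.card (∀ i, Fin (d i)) : ℂ) * (condE C X * extSub A M).trace =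
      (condE A (condE C X) * extSub A M).trace := by
    intro C
    rw [condE_adj A, condE_extSub, Matrix.mul_smul, Matrix.trace_smul, smul_eq_mul]
  rw [f, f, condE_condE, condE_condE, ← Finset.inter_assoc, Finset.inter_self]

lemma extSub_marg_univ (X : Matrix (∀ i, Fin (d i)) (∀ i, Fin (d i)) ℂ) :
    extSub Finset.univ (marg Finset.univ X) = X := by
  ext x y
  have : IsEmpty {j : Fin n // j ∉ Finset.univ} := ⟨fun j => j.2 (Finset.mem_univ _)⟩
  simp [extSub, marg, funext_iff]

end Sites

section Markov
variable {n : ℕ} {d : Fin n → ℕ}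

/-- Localised logarithm of a marginal. -/
noncomputable def locLog (τ : Matrix (∀ i, Fin (d i)) (∀ i, Fin (d i)) ℂ) (A : Finset (Fin n)) :
    Matrix (∀ i, Fin (d i)) (∀ i, Fin (d i)) ℂ := extSub A (matLog (marg A τ))

lemma prod_ne (hd : ∀ i, 0 < d i) (A : Finset (Fin n)) : ((∏ i ∈ A, d i : ℕ) : ℂ) ≠ 0 := by
  have : (∏ i ∈ A, d i) ≠ 0 := Finset.prod_ne_zero_iff.2 fun i _ => (hd i).ne'
  exact_mod_cast this

lemma marg_mem_locAlg (hd : ∀ i, 0 < d i) (τ : Matrix (∀ i, Fin (d i)) (∀ i, Fin (d i)) ℂ)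
    (A B : Finset (Fin n)) (hAB : A ⊆ B) : extSub A (marg A τ) ∈ locAlg d B := by
  have hD : (Fintype.card (∀ i, Fin (d i)) : ℂ) ≠ 0 := by
    have : Nonempty (∀ i, Fin (d i)) := ⟨fun i => ⟨0, hd i⟩⟩
    exact_mod_cast Fintype.card_ne_zero
  have h1 := condE_condE B A τ
  rw [Finset.inter_eq_right.2 hAB, condE_eq A τ, condE_eq B, smul_smul] at h1
  have h2 : extSub A (marg A τ) ∈ locAlg d B ↔
      ((Fintype.card (∀ i, Fin (d i)) : ℂ) * ((∏ i ∈ A, d i : ℕ) : ℂ)) • extSub A (marg A τ)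
        ∈ locAlg d B := by
    constructor
    · intro h; exact (locAlg d B).smul_mem h _
    · intro h
      have := (locAlg d B).smul_mem h
        ((Fintype.card (∀ i, Fin (d i)) : ℂ) * ((∏ i ∈ A, d i : ℕ) : ℂ))⁻¹
      rwa [smul_smul, inv_mul_cancel₀ (mul_ne_zero hD (prod_ne hd A)), one_smul] at this
  rw [h2, ← h1]
  exact (locAlg d B).smul_mem ⟨_, rfl⟩ _

lemma trace_locLog (hd : ∀ i, 0 < d i) (τ : Matrix (∀ i, Fin (d i)) (∀ i, Fin (d i)) ℂ)
    (hτ : τ.PosDef) (C B : Finset (Fin n)) (hCB : C ⊆ B) :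
    ((∏ i ∈ B, d i : ℕ) : ℝ) * ((extSub B (marg B τ) * locLog τ C).trace).re =
      - ((∏ i, d i : ℕ) : ℝ) * vnEntropy (marg C τ) := by
  have h1 := trace_pair hd C B τ (matLog (marg C τ))
  have h2 := trace_pair hd C Finset.univ τ (matLog (marg C τ))
  rw [Finset.inter_eq_left.2 hCB] at h1
  rw [Finset.inter_univ, extSub_marg_univ, Matrix.trace_mul_comm τ, trace_extSub_mul,
    Matrix.trace_mul_comm] at h2
  have h3 := congrArg Complex.re (h1.trans h2.symm)
  rw [← Complex.ofReal_natCast, ← Complex.ofReal_natCast, Complex.re_ofReal_mul,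
    Complex.re_ofReal_mul, trace_mul_matLog _ (marg_posDef hd C τ hτ)] at h3
  rw [locLog, h3]; ring

theorem locLog_markov (hd : ∀ i, 0 < d i) (τ : Matrix (∀ i, Fin (d i)) (∀ i, Fin (d i)) ℂ)
    (hτ : τ.PosDef) (U W S : Finset (Fin n)) (hUW : Disjoint U W) (hUS : Disjoint U S)
    (hWS : Disjoint W S) (h : qcmiSets U W S τ = 0) :
    locLog τ (U ∪ W ∪ S) = locLog τ (U ∪ S) + locLog τ (W ∪ S) - locLog τ S := by
  have hpd : ∀ A, (extSub A (marg A τ)).PosDef := fun A => extSub_posDef A _ (marg_posDef hd A τ hτ)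
  have hlog : ∀ A, matLog (extSub A (marg A τ)) = locLog τ A := fun A =>
    matLog_extSub A _ (marg_posDef hd A τ hτ)
  have i1 : (W ∪ S) ∩ (U ∪ W ∪ S) = W ∪ S := by
    rw [Finset.inter_eq_left]; intro x; simp only [Finset.mem_union]; tauto
  have i2 : (W ∪ S) ∩ (U ∪ S) = S := by
    ext x
    have : x ∈ U → x ∉ W := fun hx => Finset.disjoint_left.1 hUW hx
    simp only [Finset.mem_union, Finset.mem_inter]; tauto
  have hprod : ((∏ i ∈ W ∪ S, d i : ℕ) : ℂ) * ((∏ i ∈ U ∪ S, d i : ℕ) : ℂ) =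
      ((∏ i ∈ S, d i : ℕ) : ℂ) * ((∏ i ∈ U ∪ W ∪ S, d i : ℕ) : ℂ) := by
    rw [Finset.prod_union hWS, Finset.prod_union hUS, Finset.prod_union
      (Finset.disjoint_union_left.2 ⟨hUS, hWS⟩), Finset.prod_union hUW]
    push_cast; ring
  have hab := abstract_equality (extSub (U ∪ W ∪ S) (marg (U ∪ W ∪ S) τ))
    (extSub (U ∪ S) (marg (U ∪ S) τ)) (extSub (W ∪ S) (marg (W ∪ S) τ)) (extSub S (marg S τ))
    (hpd _) (hpd _) (hpd _) (hpd _)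
    (((∏ i ∈ W ∪ S, d i : ℕ) : ℂ) / ((∏ i ∈ U ∪ W ∪ S, d i : ℕ) : ℂ))
    (locAlg d (W ∪ S)) (by
      rintro _ ⟨M, rfl⟩
      exact ⟨Mᴴ, extSub_star _ M⟩)
    ⟨_, rfl⟩ (marg_mem_locAlg hd τ _ _ Finset.subset_union_right)
    (by
      rintro _ ⟨M, rfl⟩
      have := trace_pair hd (W ∪ S) (U ∪ W ∪ S) τ M
      rw [i1] at this
      have h0 := prod_ne hd (U ∪ W ∪ S)
      rw [div_mul_eq_mul_div, eq_div_iff h0, ← this]; ring)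
    (by
      rintro _ ⟨M, rfl⟩
      have := trace_pair hd (W ∪ S) (U ∪ S) τ M
      rw [i2] at this
      have h0 := prod_ne hd (U ∪ W ∪ S)
      have h1 := prod_ne hd (U ∪ S)
      rw [div_mul_eq_mul_div, eq_div_iff h0]
      apply mul_left_cancel₀ h1
      linear_combination ((∏ i ∈ U ∪ W ∪ S, d i : ℕ) : ℂ) * this -
        (extSub S (marg S τ) * extSub (W ∪ S) M).trace * hprod)
    (by
      rw [hlog, hlog, hlog, hlog]
      have t1 := trace_locLog hd τ hτ (U ∪ W ∪ S) (U ∪ W ∪ S) subset_rfl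
      have t2 := trace_locLog hd τ hτ (U ∪ S) (U ∪ W ∪ S)
        (by intro x; simp only [Finset.mem_union]; tauto)
      have t3 := trace_locLog hd τ hτ (W ∪ S) (U ∪ W ∪ S)
        (by intro x; simp only [Finset.mem_union]; tauto)
      have t4 := trace_locLog hd τ hτ S (U ∪ W ∪ S) Finset.subset_union_right
      have h0 : ((∏ i ∈ U ∪ W ∪ S, d i : ℕ) : ℝ) ≠ 0 := by
        exact_mod_cast prod_ne hd (U ∪ W ∪ S)
      apply mul_left_cancel₀ h0
      simp only [Matrix.mul_sub, Matrix.trace_sub, Complex.sub_re]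
      rw [qcmiSets] at h
      linear_combination t2 - t1 - t4 + t3 - ((∏ i, d i : ℕ) : ℝ) * h)
  rw [hlog, hlog, hlog, hlog] at hab
  rw [sub_eq_sub_iff_add_eq_add] at hab
  rw [eq_sub_iff_add_eq, hab]
  abel

lemma tree_induction (G : SimpleGraph (Fin n)) [DecidableRel G.Adj] (hT : G.IsTree)
    {M : Type*} [AddCommGroup M] [Module ℂ M] (Λ : Finset (Fin n) → M)
    (hΛ : ∀ U W S : Finset (Fin n), Disjoint U W → Disjoint U S → Disjoint W S →
      SeparatesIn G U W S → Λ (U ∪ W ∪ S) = Λ (U ∪ S) + Λ (W ∪ S) - Λ S) (r : Fin n) :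
    ∀ k, k + 1 ≤ n → ∃ A : Finset (Fin n), A.card = k + 1 ∧ r ∈ A ∧
      (∀ x ∈ A, ∃ p : G.Walk x r, ∀ y ∈ p.support, y ∈ A) ∧
      (2 : ℂ) • Λ A = (∑ i ∈ A, ∑ j ∈ A, if G.Adj i j then (Λ {i, j} - Λ {i} - Λ {j}) else 0)
        + (2 : ℂ) • ∑ i ∈ A, Λ {i} := by
  intro k
  induction k with
  | zero =>
    intro _
    refine ⟨{r}, by simp, by simp, ?_, by simp⟩
    intro x hx
    rw [Finset.mem_singleton] at hx
    subst hx
    exact ⟨SimpleGraph.Walk.nil, by simp⟩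
  | succ k ih =>
    intro hk
    obtain ⟨A, hcard, hr, hconn, hsum⟩ := ih (by omega)
    obtain ⟨v0, hv0⟩ : ∃ v, v ∉ A := by
      by_contra hcon
      push Not at hcon
      have : A = Finset.univ := Finset.eq_univ_iff_forall.2 hcon
      rw [this, Finset.card_univ, Fintype.card_fin] at hcard
      omega
    obtain ⟨q⟩ := hT.connected.preconnected r v0
    obtain ⟨dd, _, hp, hv⟩ := q.exists_boundary_dart (A : Set (Fin n)) hr hv0
    obtain ⟨⟨p, v⟩, hadj⟩ := dd
    simp only [Finset.mem_coe] at hp hv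
    simp only at hadj
    have hbr := (SimpleGraph.isAcyclic_iff_forall_adj_isBridge.1 hT.isAcyclic) hadj.symm
    rw [SimpleGraph.isBridge_iff_forall_walk_mem_edges] at hbr
    have hsep : ∀ w ∈ A, w ≠ p → ∀ q : G.Walk v w, p ∈ q.support := by
      intro w hw hwp q
      by_contra hnot
      obtain ⟨q1, hq1⟩ := hconn w hw
      obtain ⟨q2, hq2⟩ := hconn p hp
      have := hbr (q.append (q1.append q2.reverse))
      rw [SimpleGraph.Walk.edges_append, SimpleGraph.Walk.edges_append, List.mem_append,
        List.mem_append] at this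
      rcases this with h | h | h
      · exact hnot (SimpleGraph.Walk.snd_mem_support_of_mem_edges _ h)
      · exact hv (hq1 _ (SimpleGraph.Walk.fst_mem_support_of_mem_edges _ h))
      · have := SimpleGraph.Walk.fst_mem_support_of_mem_edges _ h
        rw [SimpleGraph.Walk.support_reverse, List.mem_reverse] at this
        exact hv (hq2 _ this)
    have hvp : v ≠ p := fun h => hv (h ▸ hp)
    have hmk := hΛ {v} (A.erase p) {p}
      (by simp [hv]) (by simp [hvp]) (by simp)
      (by
        intro u hu w hw q
        rw [Finset.mem_singleton] at hu
        subst hu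
        rw [Finset.mem_erase] at hw
        exact ⟨p, by simp, hsep w hw.2 hw.1 q⟩)
    have e1 : ({v} ∪ A.erase p ∪ {p} : Finset (Fin n)) = insert v A := by
      ext x
      simp only [Finset.mem_union, Finset.mem_singleton, Finset.mem_erase, Finset.mem_insert]
      by_cases hx : x = p
      · subst hx; simp [hp]
      · simp [hx]
    have e2 : (A.erase p ∪ {p} : Finset (Fin n)) = A := by
      ext x
      simp only [Finset.mem_union, Finset.mem_singleton, Finset.mem_erase]
      by_cases hx : x = p
      · subst hx; simp [hp]
      · simp [hx]
    have e3 : ({v} ∪ {p} : Finset (Fin n)) = {v, p} := rfl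
    rw [e1, e2, e3] at hmk
    have hnb : ∀ j ∈ A, G.Adj v j ↔ j = p := by
      intro j hj
      constructor
      · intro hvj
        by_contra hjp
        have := hsep j hj hjp (SimpleGraph.Walk.cons hvj SimpleGraph.Walk.nil)
        simp at this
        rcases this with h | h
        · exact hvp h.symm
        · exact hjp h.symm
      · rintro rfl; exact hadj.symm
    refine ⟨insert v A, ?_, Finset.mem_insert_of_mem hr, ?_, ?_⟩
    · rw [Finset.card_insert_of_notMem hv, hcard]
    · intro x hx
      rw [Finset.mem_insert] at hx
      rcases hx with rfl | hx
      · obtain ⟨q1, hq1⟩ := hconn p hp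
        refine ⟨SimpleGraph.Walk.cons hadj.symm q1, ?_⟩
        intro y hy
        rw [SimpleGraph.Walk.support_cons, List.mem_cons] at hy
        rcases hy with rfl | hy
        · exact Finset.mem_insert_self _ _
        · exact Finset.mem_insert_of_mem (hq1 y hy)
      · obtain ⟨q1, hq1⟩ := hconn x hx
        exact ⟨q1, fun y hy => Finset.mem_insert_of_mem (hq1 y hy)⟩
    · have s1 : ∑ j ∈ A, (if G.Adj v j then (Λ {v, j} - Λ {v} - Λ {j}) else 0) =
          Λ {v, p} - Λ {v} - Λ {p} := by
        rw [Finset.sum_eq_single_of_mem p hp]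
        · rw [if_pos hadj.symm]
        · intro j hj hjp
          rw [if_neg (fun h => hjp ((hnb j hj).1 h))]
      have s2 : ∑ i ∈ A, (if G.Adj i v then (Λ {i, v} - Λ {i} - Λ {v}) else 0) =
          Λ {v, p} - Λ {v} - Λ {p} := by
        rw [← s1]
        refine Finset.sum_congr rfl fun i _ => ?_
        simp only [G.adj_comm i v, Finset.pair_comm i v]
        split_ifs
        · abel
        · rfl
      rw [Finset.sum_insert hv, Finset.sum_insert hv, if_neg (G.loopless.irrefl v), s1]
      have s3 : ∀ i ∈ A, ∑ j ∈ insert v A, (if G.Adj i j then (Λ {i, j} - Λ {i} - Λ {j}) else 0) =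
          (if G.Adj i v then (Λ {i, v} - Λ {i} - Λ {v}) else 0) +
          ∑ j ∈ A, (if G.Adj i j then (Λ {i, j} - Λ {i} - Λ {j}) else 0) := by
        intro i _
        rw [Finset.sum_insert hv]
      rw [Finset.sum_congr rfl s3, Finset.sum_add_distrib, s2, Finset.sum_insert hv, hmk]
      rw [smul_sub, smul_add, hsum]
      module

lemma tree_sum (G : SimpleGraph (Fin n)) [DecidableRel G.Adj] (hT : G.IsTree)
    {M : Type*} [AddCommGroup M] [Module ℂ M] (Λ : Finset (Fin n) → M)
    (hΛ : ∀ U W S : Finset (Fin n), Disjoint U W → Disjoint U S → Disjoint W S →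
      SeparatesIn G U W S → Λ (U ∪ W ∪ S) = Λ (U ∪ S) + Λ (W ∪ S) - Λ S) :
    Λ Finset.univ = ∑ p ∈ edgePairs G, Λ {p.1, p.2} - ∑ i, ((G.degree i : ℂ) - 1) • Λ {i} := by
  obtain ⟨r⟩ := hT.connected.nonempty
  have hn : 0 < n := r.pos
  obtain ⟨A, hcard, -, -, hsum⟩ := tree_induction G hT Λ hΛ r (n - 1) (by omega)
  have hA : A = Finset.univ := by
    rw [← Finset.card_eq_iff_eq_univ, hcard, Fintype.card_fin]; omega
  subst hA
  have hdeg : ∀ (i : Fin n) (m : M), ∑ j, (if G.Adj i j then m else 0) = (G.degree i : ℂ) • m := by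
    intro i m
    rw [← Finset.sum_filter, Finset.sum_const, ← SimpleGraph.neighborFinset_eq_filter,
      SimpleGraph.card_neighborFinset_eq_degree, Nat.cast_smul_eq_nsmul]
  have hsplit : (∑ i, ∑ j, if G.Adj i j then (Λ {i, j} - Λ {i} - Λ {j}) else 0) =
      (∑ i, ∑ j, if G.Adj i j then Λ {i, j} else 0) - (2 : ℂ) • ∑ i, (G.degree i : ℂ) • Λ {i} := by
    have a : ∀ i j, (if G.Adj i j then (Λ {i, j} - Λ {i} - Λ {j}) else 0) =
        (if G.Adj i j then Λ {i, j} else 0) - (if G.Adj i j then Λ {i} else 0) -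
          (if G.Adj i j then Λ {j} else 0) := by
      intro i j; split_ifs <;> simp
    have b : (∑ i, ∑ j, if G.Adj i j then Λ {j} else 0) = ∑ i, (G.degree i : ℂ) • Λ {i} := by
      rw [Finset.sum_comm]
      refine Finset.sum_congr rfl fun i _ => ?_
      rw [← hdeg]
      refine Finset.sum_congr rfl fun j _ => ?_
      simp only [G.adj_comm j i]
    simp only [a, Finset.sum_sub_distrib, b, hdeg]
    module
  have hedge : (∑ i, ∑ j, if G.Adj i j then Λ {i, j} else 0) =
      (2 : ℂ) • ∑ p ∈ edgePairs G, Λ {p.1, p.2} := by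
    have hE : ∑ p ∈ edgePairs G, Λ {p.1, p.2} =
        ∑ i, ∑ j, if i < j ∧ G.Adj i j then Λ {i, j} else 0 := by
      rw [edgePairs, Finset.sum_filter, Fintype.sum_prod_type]
    have hE2 : ∑ p ∈ edgePairs G, Λ {p.1, p.2} =
        ∑ i, ∑ j, if j < i ∧ G.Adj i j then Λ {i, j} else 0 := by
      rw [hE, Finset.sum_comm]
      refine Finset.sum_congr rfl fun i _ => Finset.sum_congr rfl fun j _ => ?_
      simp only [G.adj_comm j i, Finset.pair_comm j i]
    rw [two_smul]
    nth_rewrite 1 [hE]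
    rw [hE2, ← Finset.sum_add_distrib]
    refine Finset.sum_congr rfl fun i _ => ?_
    rw [← Finset.sum_add_distrib]
    refine Finset.sum_congr rfl fun j _ => ?_
    rcases lt_trichotomy i j with h | h | h
    · simp [h, h.not_gt]
    · subst h; simp
    · simp [h, h.not_gt]
  rw [hsplit, hedge] at hsum
  have h2 : (2 : ℂ) ≠ 0 := two_ne_zero
  apply smul_right_injective M h2
  simp only [] at *
  rw [hsum]
  simp only [sub_smul, one_smul, Finset.sum_sub_distrib]
  module

end Markov

/-- For an invertible density operator `σ` on a multipartite space
satisfying the global Markov property with respect to a tree `T`, its logarithm decomposes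
along the tree: `log σ = ∑_{{i,j}∈E} log σ_{ij} − ∑_i (deg(i) − 1) log σ_i`, with the
marginals extended to the full space by tensoring with identities. -/
theorem globalMarkov_log_decomposition {n : ℕ} {d : Fin n → ℕ}
    (G : SimpleGraph (Fin n)) [DecidableRel G.Adj] (hT : G.IsTree)
    (σ : Matrix (∀ i, Fin (d i)) (∀ i, Fin (d i)) ℂ)
    (hσ : IsDensity σ) (hσinv : IsUnit σ)
    (hGM : GlobalMarkov G σ) :
    matLog σ =
      (∑ p ∈ edgePairs G, extSub {p.1, p.2} (matLog (marg {p.1, p.2} σ)))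
        - ∑ i, ((G.degree i : ℂ) - 1) • extSub {i} (matLog (marg {i} σ)) := by
  have hpd : σ.PosDef := hσ.1.posDef_iff_isUnit.2 hσinv
  have hd : ∀ i, 0 < d i := by
    intro i
    by_contra h0
    have h0' : d i = 0 := by omega
    have : IsEmpty (∀ i, Fin (d i)) := ⟨fun x => by
      have := (x i).2
      omega⟩
    have h1 := hσ.2
    simp [Matrix.trace] at h1
  have h := tree_sum G hT (locLog σ) (fun U W S h1 h2 h3 h4 =>
    locLog_markov hd σ hpd U W S h1 h2 h3 (hGM U W S h1 h2 h3 h4))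
  have hu : locLog σ Finset.univ = matLog σ := by
    rw [locLog, ← matLog_extSub _ _ (marg_posDef hd _ σ hpd), extSub_marg_univ]
  rw [← hu, h]
  rfl
end
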